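/- arXiv:2508.13466 — 5 statements merged into one kernel-verified Lean document; each statement's English description precedes it below -/
import Mathlib

section
/- Let b, m, k be integers with b ≥ k ≥ 3 and m ≥ 1. Then every tree T with b leaves and matching number m, with leaves as boundary, satisfies σ_k(T) ≤ 1, and the spider graph Sp_{1,b−1;2m−1,1} is a tree with b leaves and matching number m achieving σ_k = 1. -/
open scoped Classical

noncomputable section

/-- The `k`-th smallest root (1-based, with multiplicity) of the characteristic polynomial
of a real matrix.  For a symmetric matrix these are exactly its eigenvalues listed
in nondecreasing order. -/
def kthEig {ι : Type*} [Fintype ι] [DecidableEq ι] (M : Matrix ι ι ℝ) (k : ℕ) : ℝ :=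
  (M.charpoly.roots.sort (· ≤ ·)).getD (k - 1) 0

/-- The `k`-th smallest Laplacian eigenvalue (1-based); `lapEig G 2` is the algebraic
connectivity. -/
def lapEig {V : Type*} [Fintype V] (G : SimpleGraph V) (k : ℕ) : ℝ :=
  kthEig (SimpleGraph.lapMatrix ℝ G) k

/-- The Steklov (Dirichlet-to-Neumann) matrix of a graph with boundary `B`:
the Schur complement of the interior block of the Laplacian, i.e. the matrix of the map
sending `f : B → ℝ` to the normal derivative of its harmonic extension. -/
def steklovMatrix {V : Type*} [Fintype V] (G : SimpleGraph V) (B : Set V) :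
    Matrix B B ℝ :=
  let L := SimpleGraph.lapMatrix ℝ G
  L.submatrix (Subtype.val : B → V) (Subtype.val : B → V) -
    L.submatrix (Subtype.val : B → V) (Subtype.val : (Bᶜ : Set V) → V) *
      (L.submatrix (Subtype.val : (Bᶜ : Set V) → V) (Subtype.val : (Bᶜ : Set V) → V))⁻¹ *
      L.submatrix (Subtype.val : (Bᶜ : Set V) → V) (Subtype.val : B → V)

/-- The `k`-th smallest Steklov eigenvalue (1-based). -/
def steklovEig {V : Type*} [Fintype V] (G : SimpleGraph V) (B : Set V) (k : ℕ) : ℝ :=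
  kthEig (steklovMatrix G B) k

/-- The set of leaves (vertices of degree 1) of a graph. -/
def leaves {V : Type*} (G : SimpleGraph V) : Set V := {v | (G.neighborSet v).ncard = 1}

/-- A set of edges is a matching if the edges belong to the graph and are pairwise
vertex-disjoint. -/
def IsMatchingSet {V : Type*} (G : SimpleGraph V) (s : Set (Sym2 V)) : Prop :=
  s ⊆ G.edgeSet ∧ s.Pairwise fun e f => ∀ v, v ∈ e → v ∉ f

/-- The matching number of a graph: the maximum size of a matching. -/
def matchingNumber {V : Type*} [Fintype V] (G : SimpleGraph V) : ℕ :=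
  sSup {n | ∃ s : Set (Sym2 V), IsMatchingSet G s ∧ s.ncard = n}

/-- The star graph on `n` vertices. -/
def starGraph (n : ℕ) : SimpleGraph (Fin n) :=
  SimpleGraph.fromRel (fun i _ => i.val = 0)

/-- Vertices of the spider graph with two leg lengths. -/
abbrev Spider2V (p₁ p₂ ℓ₁ ℓ₂ : ℕ) := Option ((Fin p₁ × Fin ℓ₁) ⊕ (Fin p₂ × Fin ℓ₂))

def spider2Rel (p₁ p₂ ℓ₁ ℓ₂ : ℕ) :
    Spider2V p₁ p₂ ℓ₁ ℓ₂ → Spider2V p₁ p₂ ℓ₁ ℓ₂ → Prop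
  | none, some (Sum.inl (_, j)) => j.val = 0
  | none, some (Sum.inr (_, j)) => j.val = 0
  | some (Sum.inl (i, j)), some (Sum.inl (i', j')) => i = i' ∧ j'.val = j.val + 1
  | some (Sum.inr (i, j)), some (Sum.inr (i', j')) => i = i' ∧ j'.val = j.val + 1
  | _, _ => False

/-- The spider graph `Sp_{p₁,p₂;ℓ₁,ℓ₂}`: `p₁` paths of length `ℓ₁` and `p₂` paths of
length `ℓ₂`, with one endpoint of each path identified to a common center (`none`). -/
def spider2 (p₁ p₂ ℓ₁ ℓ₂ : ℕ) : SimpleGraph (Spider2V p₁ p₂ ℓ₁ ℓ₂) :=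
  SimpleGraph.fromRel (spider2Rel p₁ p₂ ℓ₁ ℓ₂)

/-- Vertices of the crab graph. -/
abbrev CrabV (b₁ b₂ r : ℕ) := Option (Fin b₁ × Fin r) ⊕ Option (Fin b₂ × Fin r)

def crabRel (b₁ b₂ r : ℕ) : CrabV b₁ b₂ r → CrabV b₁ b₂ r → Prop
  | Sum.inl none, Sum.inr none => True
  | Sum.inl none, Sum.inl (some (_, j)) => j.val = 0
  | Sum.inl (some (i, j)), Sum.inl (some (i', j')) => i = i' ∧ j'.val = j.val + 1
  | Sum.inr none, Sum.inr (some (_, j)) => j.val = 0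
  | Sum.inr (some (i, j)), Sum.inr (some (i', j')) => i = i' ∧ j'.val = j.val + 1
  | _, _ => False

/-- The crab graph `CG_{b₁,b₂;r}`: two spiders `Sp_{b₁;r}` and `Sp_{b₂;r}` with their
centers joined by an edge. -/
def crab (b₁ b₂ r : ℕ) : SimpleGraph (CrabV b₁ b₂ r) :=
  SimpleGraph.fromRel (crabRel b₁ b₂ r)


theorem kthEig_le_of_posSemidef {ι : Type*} [Fintype ι] [DecidableEq ι] {N : Matrix ι ι ℝ}
    (hN : N.PosSemidef) (k : ℕ) : kthEig (1 - N) k ≤ 1 := by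
  have h : ∀ x ∈ (1 - N).charpoly.roots.sort (· ≤ ·), x ≤ 1 := by
    intro x hx
    rw [Multiset.mem_sort] at hx
    have hM : (1 - N).IsHermitian := Matrix.isHermitian_one.sub hN.1
    rw [hM.roots_charpoly_eq_eigenvalues] at hx
    obtain ⟨i, -, rfl⟩ := Multiset.mem_map.1 hx
    have h1 : (1 - N).mulVec (hM.eigenvectorBasis i) =
        hM.eigenvalues i • ⇑(hM.eigenvectorBasis i) := hM.mulVec_eigenvectorBasis i
    set v : ι → ℝ := ⇑(hM.eigenvectorBasis i) with hv
    have hv0 : v ≠ 0 := by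
      intro h0
      apply (hM.eigenvectorBasis.orthonormal.ne_zero i)
      ext j
      exact congrFun h0 j
    have h2 := hN.dotProduct_mulVec_nonneg v
    rw [Matrix.sub_mulVec, Matrix.one_mulVec] at h1
    have h3 : N.mulVec v = (1 - hM.eigenvalues i) • v := by
      rw [sub_smul, one_smul]
      rw [← h1, sub_sub_cancel]
    rw [h3, star_trivial, dotProduct_smul, smul_eq_mul] at h2
    have h4 : 0 < v ⬝ᵥ v := by
      have := Matrix.dotProduct_star_self_pos_iff.2 hv0
      simpa using this
    have := nonneg_of_mul_nonneg_left h2 h4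
    simpa using this
  unfold kthEig
  by_cases hk : k - 1 < ((1 - N).charpoly.roots.sort (· ≤ ·)).length
  · rw [List.getD_eq_getElem _ _ hk]
    exact h _ (List.getElem_mem hk)
  · rw [List.getD_eq_default _ _ (not_lt.1 hk)]
    exact zero_le_one

theorem List.one_le_getElem_of_count {l : List ℝ} (hl : l.Pairwise (· ≤ ·)) {j r : ℕ}
    (hcount : l.length ≤ l.count 1 + r) (hj : j < l.length) (hr : r ≤ j) : 1 ≤ l[j] := by
  by_contra! hlt
  have h0 : (l.take (j + 1)).count 1 = 0 := by
    rw [List.count_eq_zero]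
    intro hmem
    obtain ⟨i, hi, hi1⟩ := List.mem_iff_getElem.1 hmem
    rw [List.getElem_take] at hi1
    rw [List.length_take] at hi
    have : l[i] ≤ l[j] := by
      rcases Nat.lt_or_ge i j with hij | hij
      · exact List.pairwise_iff_getElem.1 hl i j _ _ hij
      · have : i = j := by omega
        subst this
        exact le_rfl
    linarith
  have h1 := List.count_append (a := (1 : ℝ)) (l₁ := l.take (j + 1)) (l₂ := l.drop (j + 1))
  rw [List.take_append_drop, h0] at h1
  have h2 := List.count_le_length (a := (1 : ℝ)) (l := l.drop (j + 1))
  rw [List.length_drop] at h2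
  omega

theorem one_le_kthEig_of_rank_le {ι : Type*} [Fintype ι] [DecidableEq ι] {N : Matrix ι ι ℝ}
    (hN : N.IsHermitian) {r k : ℕ} (hr : N.rank ≤ r) (hk : r < k) (hkι : k ≤ Fintype.card ι) :
    1 ≤ kthEig (1 - N) k := by
  have hM : (1 - N).IsHermitian := Matrix.isHermitian_one.sub hN
  have hlen : ((1 - N).charpoly.roots.sort (· ≤ ·)).length = Fintype.card ι := by
    rw [Multiset.length_sort, hM.roots_charpoly_eq_eigenvalues]
    simp
  have hcount : Fintype.card ι ≤ ((1 - N).charpoly.roots.sort (· ≤ ·)).count 1 + r := by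
    rw [← Multiset.coe_count, Multiset.sort_eq, Polynomial.count_roots]
    have h1 := LinearMap.finrank_eigenspace_le (Matrix.toLin' (1 - N)) 1
    rw [Matrix.charpoly_toLin'] at h1
    have h2 : Module.End.eigenspace (Matrix.toLin' (1 - N)) 1 = LinearMap.ker N.mulVecLin := by
      ext v
      rw [Module.End.mem_eigenspace_iff, Matrix.toLin'_apply, Matrix.sub_mulVec,
        Matrix.one_mulVec, one_smul, sub_eq_self, LinearMap.mem_ker, Matrix.mulVecLin_apply]
    rw [h2] at h1
    have h3 := N.mulVecLin.finrank_range_add_finrank_ker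
    rw [Module.finrank_fintype_fun_eq_card] at h3
    unfold Matrix.rank at hr
    omega
  unfold kthEig
  have hk' : k - 1 < ((1 - N).charpoly.roots.sort (· ≤ ·)).length := by omega
  rw [List.getD_eq_getElem _ _ hk']
  exact List.one_le_getElem_of_count (Multiset.pairwise_sort _ _) (hlen ▸ hcount) hk' (by omega)

theorem not_adj_of_mem_leaves {V : Type*} [Fintype V] {G : SimpleGraph V} (hG : G.Connected)
    (h3 : 3 ≤ (leaves G).ncard) {u v : V} (hu : u ∈ leaves G) (hv : v ∈ leaves G) :
    ¬ G.Adj u v := by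
  intro huv
  obtain ⟨a, ha⟩ := Set.ncard_eq_one.1 hu
  obtain ⟨c, hc⟩ := Set.ncard_eq_one.1 hv
  have hav : v = a := by
    have : v ∈ G.neighborSet u := huv
    rwa [ha] at this
  have hcu : u = c := by
    have : u ∈ G.neighborSet v := huv.symm
    rwa [hc] at this
  have key : ∀ w, Relation.ReflTransGen G.Adj u w → w = u ∨ w = v := by
    intro w hw
    induction hw with
    | refl => exact Or.inl rfl
    | tail _ hadj ih =>
      rename_i x y _
      rcases ih with rfl | rfl
      · have : y ∈ G.neighborSet x := hadj
        rw [ha] at this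
        exact Or.inr (this.trans hav.symm)
      · have : y ∈ G.neighborSet x := hadj
        rw [hc] at this
        exact Or.inl (this.trans hcu.symm)
  have hsub : leaves G ⊆ {u, v} := fun w _ =>
    key w ((SimpleGraph.reachable_iff_reflTransGen _ _).1 (hG.preconnected u w))
  have := Set.ncard_le_ncard hsub
  have := Set.ncard_insert_le u {v}
  rw [Set.ncard_singleton] at this
  omega

/-- The block of the Laplacian with rows in `B` and columns outside `B`. -/
def lapBoundaryBlock {V : Type*} [Fintype V] (G : SimpleGraph V) (B : Set V) :
    Matrix B (Bᶜ : Set V) ℝ :=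
  (SimpleGraph.lapMatrix ℝ G).submatrix Subtype.val Subtype.val

theorem lapBoundaryBlock_apply {V : Type*} [Fintype V] (G : SimpleGraph V) (B : Set V) (u : B)
    (v : (Bᶜ : Set V)) : lapBoundaryBlock G B u v = if G.Adj u v then -1 else 0 := by
  have hne : u.1 ≠ v.1 := fun h => v.2 (h ▸ u.2)
  rw [lapBoundaryBlock, Matrix.submatrix_apply, SimpleGraph.lapMatrix, Matrix.sub_apply,
    SimpleGraph.degMatrix, Matrix.diagonal_apply_ne _ hne, SimpleGraph.adjMatrix_apply]
  split_ifs <;> simp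

/-- The block of the Laplacian with rows and columns outside `B`. -/
def lapInteriorBlock {V : Type*} [Fintype V] (G : SimpleGraph V) (B : Set V) :
    Matrix (Bᶜ : Set V) (Bᶜ : Set V) ℝ :=
  (SimpleGraph.lapMatrix ℝ G).submatrix Subtype.val Subtype.val

theorem steklovMatrix_leaves {V : Type*} [Fintype V] {G : SimpleGraph V} (hG : G.Connected)
    (h3 : 3 ≤ (leaves G).ncard) :
    steklovMatrix G (leaves G) = 1 - lapBoundaryBlock G (leaves G) *
      (lapInteriorBlock G (leaves G))⁻¹ * (lapBoundaryBlock G (leaves G)).conjTranspose := by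
  have h1 : (SimpleGraph.lapMatrix ℝ G).submatrix (Subtype.val : leaves G → V)
      (Subtype.val : leaves G → V) = 1 := by
    ext u v
    rw [Matrix.submatrix_apply, SimpleGraph.lapMatrix, Matrix.sub_apply,
      SimpleGraph.adjMatrix_apply, if_neg (not_adj_of_mem_leaves hG h3 u.2 v.2), sub_zero,
      SimpleGraph.degMatrix, Matrix.diagonal_apply, Matrix.one_apply]
    have hd : G.degree u = 1 := by
      have : (G.neighborSet u.1).ncard = 1 := u.2
      rw [Set.ncard_eq_toFinset_card'] at this
      rw [← this, ← SimpleGraph.card_neighborFinset_eq_degree, SimpleGraph.neighborFinset]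
    simp [hd, Subtype.ext_iff]
  have h2 : (SimpleGraph.lapMatrix ℝ G).submatrix (Subtype.val : ((leaves G)ᶜ : Set V) → V)
      (Subtype.val : leaves G → V) = (lapBoundaryBlock G (leaves G)).conjTranspose := by
    rw [lapBoundaryBlock, Matrix.conjTranspose_submatrix,
      (SimpleGraph.isHermitian_lapMatrix (R := ℝ) (G := G)).eq]
  unfold steklovMatrix
  simp only [h1, h2]
  rfl

theorem posSemidef_schurCorrection {V : Type*} [Fintype V] (G : SimpleGraph V) (B : Set V) :
    (lapBoundaryBlock G B * (lapInteriorBlock G B)⁻¹ *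
      (lapBoundaryBlock G B).conjTranspose).PosSemidef :=
  (((SimpleGraph.posSemidef_lapMatrix ℝ G).submatrix _).inv).mul_mul_conjTranspose_same _

theorem steklovEig_leaves_le_one {V : Type*} [Fintype V] {G : SimpleGraph V} (hG : G.Connected)
    (h3 : 3 ≤ (leaves G).ncard) (k : ℕ) : steklovEig G (leaves G) k ≤ 1 := by
  unfold steklovEig
  rw [steklovMatrix_leaves hG h3]
  exact kthEig_le_of_posSemidef (posSemidef_schurCorrection G _) k

theorem one_le_steklovEig_leaves {V : Type*} [Fintype V] {G : SimpleGraph V} (hG : G.Connected)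
    {r k : ℕ} (hr : (lapBoundaryBlock G (leaves G)).rank ≤ r) (hrk : r < k) (h3 : 3 ≤ k)
    (hk : k ≤ (leaves G).ncard) : 1 ≤ steklovEig G (leaves G) k := by
  unfold steklovEig
  rw [steklovMatrix_leaves hG (h3.trans hk)]
  refine one_le_kthEig_of_rank_le (posSemidef_schurCorrection G _).1 ?_ hrk ?_
  · rw [Matrix.mul_assoc]
    exact (Matrix.rank_mul_le_left _ _).trans hr
  · rwa [← Nat.card_eq_fintype_card, Nat.card_coe_set_eq]

theorem rank_le_two_of_rows {m n : Type*} [Fintype m] [Fintype n] (A : Matrix m n ℝ)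
    (x y : n → ℝ) (h : ∀ i, A.row i = x ∨ A.row i = y) : A.rank ≤ 2 := by
  rw [Matrix.rank_eq_finrank_span_row]
  have hsub : Set.range A.row ⊆ (({x, y} : Finset (n → ℝ)) : Set (n → ℝ)) := by
    rintro _ ⟨i, rfl⟩
    simpa using h i
  refine (Submodule.finrank_mono (Submodule.span_mono hsub)).trans ?_
  exact (finrank_span_finset_le_card _).trans Finset.card_le_two

theorem IsMatchingSet.ncard_le_of_cover {V : Type*} [Fintype V] {G : SimpleGraph V}
    {s : Set (Sym2 V)} (hs : IsMatchingSet G s) {C : Finset V}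
    (hC : ∀ u v, G.Adj u v → u ∈ C ∨ v ∈ C) : s.ncard ≤ C.card := by
  have hex : ∀ e : Sym2 V, ∃ v, e ∈ s → v ∈ C ∧ v ∈ e := by
    intro e
    by_cases he : e ∈ s
    swap
    · exact ⟨(Quot.out e).1, fun h => absurd h he⟩
    have he' := hs.1 he
    induction e with
    | _ u v =>
      rcases hC u v he' with h | h
      · exact ⟨u, fun _ => ⟨h, Sym2.mem_mk_left u v⟩⟩
      · exact ⟨v, fun _ => ⟨h, Sym2.mem_mk_right u v⟩⟩
  choose f hf using hex
  rw [← Set.ncard_coe_finset C]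
  refine Set.ncard_le_ncard_of_injOn f (fun e he => (hf e he).1) ?_
  intro e he e' he' hee
  by_contra hne
  exact hs.2 he he' hne (f e) (hf e he).2 (hee ▸ (hf e' he').2)

theorem matchingNumber_eq {V : Type*} [Fintype V] {G : SimpleGraph V} {m : ℕ} {C : Finset V}
    (hC : ∀ u v, G.Adj u v → u ∈ C ∨ v ∈ C) (hCm : C.card ≤ m)
    {s : Set (Sym2 V)} (hs : IsMatchingSet G s) (hsm : s.ncard = m) : matchingNumber G = m := by
  refine IsGreatest.csSup_eq ⟨⟨s, hs, hsm⟩, ?_⟩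
  rintro _ ⟨t, ht, rfl⟩
  exact (ht.ncard_le_of_cover hC).trans hCm

/-- A graph in which every vertex other than the root `r` has a parent of smaller height, and in
which all edges join a vertex with its parent, is a tree. -/
theorem isTree_of_parent {V : Type*} [Fintype V] {G : SimpleGraph V} (r : V) (par : V → V)
    (ht : V → ℕ) (hpar : ∀ v, v ≠ r → G.Adj v (par v) ∧ ht (par v) < ht v)
    (hadj : ∀ u v, G.Adj u v → (u ≠ r ∧ v = par u) ∨ (v ≠ r ∧ u = par v)) : G.IsTree := by
  have hreach : ∀ n v, ht v = n → G.Reachable v r := by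
    intro n
    induction n using Nat.strong_induction_on with
    | _ n ih =>
      intro v hv
      by_cases hvr : v = r
      · exact hvr ▸ SimpleGraph.Reachable.rfl
      · obtain ⟨h1, h2⟩ := hpar v hvr
        exact h1.reachable.trans (ih _ (hv ▸ h2) _ rfl)
  have hconn : G.Connected :=
    { preconnected := fun u v => (hreach _ u rfl).trans (hreach _ v rfl).symm
      nonempty := ⟨r⟩ }
  rw [SimpleGraph.isTree_iff_connected_and_card]
  refine ⟨hconn, le_antisymm ?_ hconn.card_vert_le_card_edgeSet_add_one⟩
  have hsub : G.edgeSet ⊆ (fun v => s(v, par v)) '' {r}ᶜ := by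
    intro e he
    induction e with
    | _ u v =>
      rcases hadj u v he with ⟨h1, rfl⟩ | ⟨h1, rfl⟩
      · exact ⟨u, h1, rfl⟩
      · exact ⟨v, h1, Sym2.eq_swap⟩
  have h1 := (Set.ncard_le_ncard hsub).trans (Set.ncard_image_le (Set.toFinite _))
  have h2 := Set.ncard_add_ncard_compl ({r} : Set V)
  rw [Set.ncard_singleton] at h2
  rw [Nat.card_coe_set_eq]
  omega

namespace Spider2

variable {p ℓ : ℕ}

/-- The neighbour of a vertex of `Sp_{1,p;ℓ,1}` on its path to the center. -/
def parent : Spider2V 1 p ℓ 1 → Spider2V 1 p ℓ 1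
  | none => none
  | some (Sum.inl (i, j)) =>
    if j.val = 0 then none else some (Sum.inl (i, ⟨j.val - 1, by omega⟩))
  | some (Sum.inr _) => none

/-- The distance of a vertex of `Sp_{1,p;ℓ,1}` from the center. -/
def height : Spider2V 1 p ℓ 1 → ℕ
  | none => 0
  | some (Sum.inl (_, j)) => j.val + 1
  | some (Sum.inr _) => 1

theorem adj_iff (u v : Spider2V 1 p ℓ 1) : (spider2 1 p ℓ 1).Adj u v ↔
    (u ≠ none ∧ v = parent u) ∨ (v ≠ none ∧ u = parent v) := by
  rw [spider2, SimpleGraph.fromRel_adj]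
  rcases u with _ | ⟨i, j⟩ | ⟨i, j⟩ <;> rcases v with _ | ⟨i', j'⟩ | ⟨i', j'⟩ <;>
    simp only [spider2Rel, parent]
  · simp
  · split_ifs <;> simp_all
  · simp
  · split_ifs <;> simp_all
  · have := Subsingleton.elim i i'
    subst this
    split_ifs <;> simp [Fin.ext_iff] <;> omega
  · split_ifs <;> simp
  · simp
  · split_ifs <;> simp
  · simp

theorem isTree : (spider2 1 p ℓ 1).IsTree := by
  refine isTree_of_parent none parent height ?_ fun u v => (adj_iff u v).1
  intro v hv
  refine ⟨(adj_iff _ _).2 (Or.inl ⟨hv, rfl⟩), ?_⟩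
  rcases v with _ | ⟨i, j⟩ | ⟨i, j⟩
  · exact absurd rfl hv
  · simp only [parent]
    split_ifs <;> simp only [height] <;> omega
  · simp [parent, height]

theorem neighborSet_inr (x : Fin p × Fin 1) :
    (spider2 1 p ℓ 1).neighborSet (some (Sum.inr x)) = {none} := by
  ext v
  rw [SimpleGraph.mem_neighborSet, adj_iff, Set.mem_singleton_iff]
  constructor
  · rintro (⟨-, h⟩ | ⟨-, h⟩)
    · exact h
    · rcases v with _ | ⟨i, j⟩ | ⟨i, j⟩
      · rfl
      · simp only [parent] at h
        split_ifs at h; simp at h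
      · simp [parent] at h
  · rintro rfl
    exact Or.inl ⟨by simp, rfl⟩

theorem leaves_eq (hp : 2 ≤ p) (hℓ : 1 ≤ ℓ) : leaves (spider2 1 p ℓ 1) =
    insert (some (Sum.inl (0, ⟨ℓ - 1, by omega⟩))) (Set.range fun x => some (Sum.inr x)) := by
  ext v
  rw [leaves, Set.mem_ofPred_eq, Set.mem_insert_iff, Set.mem_range]
  rcases v with _ | ⟨i, j⟩ | x
  · simp only [reduceCtorEq, exists_false, or_self, iff_false]
    intro h
    obtain ⟨a, ha⟩ := Set.ncard_eq_one.1 h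
    have h0 : ∀ i : Fin p, some (Sum.inr (i, 0)) = a := by
      intro i
      have : (some (Sum.inr (i, 0)) : Spider2V 1 p ℓ 1) ∈ (spider2 1 p ℓ 1).neighborSet none :=
        (adj_iff _ _).2 (Or.inr ⟨by simp, rfl⟩)
      rwa [ha] at this
    have h1 := (h0 ⟨0, by omega⟩).trans (h0 ⟨1, by omega⟩).symm
    simp at h1
  · have hi := Subsingleton.elim i 0
    subst hi
    by_cases hj : j.val = ℓ - 1
    · have hj' : j = ⟨ℓ - 1, by omega⟩ := Fin.ext hj
      refine iff_of_true (Set.ncard_eq_one.2 ?_) (Or.inl (by rw [hj']))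
      refine ⟨parent (some (Sum.inl (0, j))), ?_⟩
      ext v
      rw [SimpleGraph.mem_neighborSet, adj_iff, Set.mem_singleton_iff]
      constructor
      · rintro (⟨-, h⟩ | ⟨-, h⟩)
        · exact h
        · rcases v with _ | ⟨i, j⟩ | ⟨i, j⟩
          · simp [parent] at h
          · simp only [parent] at h
            split_ifs at h
            simp [Fin.ext_iff] at h
            omega
          · simp [parent] at h
      · intro h
        exact Or.inl ⟨by simp, h⟩
    · have hne : ¬ ((some (Sum.inl (0, j)) : Spider2V 1 p ℓ 1) =
          some (Sum.inl (0, ⟨ℓ - 1, by omega⟩)) ∨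
          ∃ x, some (Sum.inr x) = (some (Sum.inl (0, j)) : Spider2V 1 p ℓ 1)) := by
        simp [Fin.ext_iff, hj]
      refine iff_of_false (fun h => ?_) hne
      obtain ⟨a, ha⟩ := Set.ncard_eq_one.1 h
      have h1 : parent (some (Sum.inl (0, j))) ∈
          (spider2 1 p ℓ 1).neighborSet (some (Sum.inl (0, j))) :=
        (adj_iff _ _).2 (Or.inl ⟨by simp, rfl⟩)
      have h2 : some (Sum.inl (0, ⟨j.val + 1, by omega⟩)) ∈
          (spider2 1 p ℓ 1).neighborSet (some (Sum.inl (0, j))) :=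
        (adj_iff _ _).2 (Or.inr ⟨by simp, by simp [parent]⟩)
      rw [ha, Set.mem_singleton_iff] at h1 h2
      have h3 := congrArg height (h1.trans h2.symm)
      simp only [parent] at h3
      split_ifs at h3 <;> simp only [height] at h3 <;> omega
  · refine iff_of_true ?_ (Or.inr ⟨x, rfl⟩)
    rw [neighborSet_inr, Set.ncard_singleton]

theorem ncard_leaves (hp : 2 ≤ p) (hℓ : 1 ≤ ℓ) :
    (leaves (spider2 1 p ℓ 1)).ncard = p + 1 := by
  rw [leaves_eq hp hℓ, Set.ncard_insert_of_notMem (by simp), ← Nat.card_coe_set_eq,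
    Nat.card_range_of_injective]
  · simp
  · intro x y h
    simpa using h

theorem rank_lapBoundaryBlock_le (hp : 2 ≤ p) (hℓ : 1 ≤ ℓ) :
    (lapBoundaryBlock (spider2 1 p ℓ 1) (leaves (spider2 1 p ℓ 1))).rank ≤ 2 := by
  have hl := leaves_eq hp hℓ
  have h0 : (some (Sum.inl (0, ⟨ℓ - 1, by omega⟩))) ∈ leaves (spider2 1 p ℓ 1) :=
    hl ▸ Set.mem_insert _ _
  refine rank_le_two_of_rows _ ((lapBoundaryBlock (spider2 1 p ℓ 1) _).row ⟨_, h0⟩)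
    (fun v => if v.1 = none then -1 else 0) ?_
  rintro ⟨u, hu⟩
  have hu' := hu
  rw [hl] at hu'
  rcases hu' with rfl | ⟨x, rfl⟩
  · exact Or.inl rfl
  · right
    funext v
    have hadj : (spider2 1 p ℓ 1).Adj (some (Sum.inr x)) v.1 ↔ v.1 = none := by
      rw [← SimpleGraph.mem_neighborSet, neighborSet_inr, Set.mem_singleton_iff]
    refine (lapBoundaryBlock_apply _ _ _ v).trans ?_
    simp only [hadj]

/-- The vertex of `Sp_{1,p;ℓ,1}` at distance `n` from the center on the long leg. -/
def legVertex (p ℓ n : ℕ) : Spider2V 1 p ℓ 1 :=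
  if h : n ≠ 0 ∧ n ≤ ℓ then some (Sum.inl (0, ⟨n - 1, by omega⟩)) else none

theorem height_legVertex {n : ℕ} (hn : n ≤ ℓ) : height (legVertex p ℓ n) = n := by
  unfold legVertex
  split_ifs with h
  · simp only [height]
    omega
  · simp only [height]
    omega

theorem adj_legVertex {n : ℕ} (hn : n + 1 ≤ ℓ) :
    (spider2 1 p ℓ 1).Adj (legVertex p ℓ n) (legVertex p ℓ (n + 1)) := by
  rw [adj_iff]
  right
  rcases Nat.eq_zero_or_pos n with rfl | h
  · simp [legVertex, parent, hn]
  · have h1 : n ≠ 0 := h.ne'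
    have h2 : n ≤ ℓ := by omega
    simp [legVertex, parent, hn, h1, h2]

theorem matchingNumber_eq (m : ℕ) (hm : 1 ≤ m) :
    matchingNumber (spider2 1 p (2 * m - 1) 1) = m := by
  have hmem : ∀ (i : Fin m) (v : Spider2V 1 p (2 * m - 1) 1),
      v ∈ s(legVertex p (2 * m - 1) (2 * i), legVertex p (2 * m - 1) (2 * i + 1)) →
        height v / 2 = i := by
    intro i v hv
    rcases Sym2.mem_iff.1 hv with rfl | rfl <;> rw [height_legVertex (by omega)] <;> omega
  refine _root_.matchingNumber_eq
    (C := Finset.univ.image fun i : Fin m => legVertex p (2 * m - 1) (2 * i))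
    (s := Set.range fun i : Fin m =>
      s(legVertex p (2 * m - 1) (2 * i), legVertex p (2 * m - 1) (2 * i + 1))) ?_
    (Finset.card_image_le.trans (by simp)) ⟨?_, ?_⟩ ?_
  · have hnone : none ∈ Finset.univ.image fun i : Fin m => legVertex p (2 * m - 1) (2 * i) :=
      Finset.mem_image.2 ⟨⟨0, hm⟩, Finset.mem_univ _, by simp [legVertex]⟩
    have hodd : ∀ i : Fin 1, ∀ j : Fin (2 * m - 1), j.val % 2 = 1 → some (Sum.inl (i, j)) ∈
        Finset.univ.image fun i : Fin m => legVertex p (2 * m - 1) (2 * i) := by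
      intro i j hj
      refine Finset.mem_image.2 ⟨⟨(j.val + 1) / 2, by omega⟩, Finset.mem_univ _, ?_⟩
      rw [legVertex, dif_pos (by constructor <;> simp only <;> omega)]
      simp only [Option.some.injEq, Sum.inl.injEq, Prod.mk.injEq, Fin.ext_iff]
      constructor <;> omega
    have hstep : ∀ u : Spider2V 1 p (2 * m - 1) 1, u ≠ none →
        u ∈ (Finset.univ.image fun i : Fin m => legVertex p (2 * m - 1) (2 * i)) ∨
        parent u ∈ Finset.univ.image fun i : Fin m => legVertex p (2 * m - 1) (2 * i) := by
      intro u hu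
      rcases u with _ | ⟨i, j⟩ | x
      · exact absurd rfl hu
      · rcases Nat.mod_two_eq_zero_or_one j.val with hj | hj
        · right
          simp only [parent]
          split_ifs with h0
          · exact hnone
          · exact hodd _ _ (by simp only; omega)
        · exact Or.inl (hodd i j hj)
      · exact Or.inr hnone
    intro u v huv
    rcases (adj_iff u v).1 huv with ⟨hu, rfl⟩ | ⟨hv, rfl⟩
    · exact hstep u hu
    · exact (hstep v hv).symm
  · rintro _ ⟨i, rfl⟩
    exact adj_legVertex (by omega)
  · rintro _ ⟨i, rfl⟩ _ ⟨j, rfl⟩ hne v hi hj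
    have hij : i = j := Fin.ext ((hmem i v hi).symm.trans (hmem j v hj))
    exact hne (by rw [hij])
  · rw [← Nat.card_coe_set_eq, Nat.card_range_of_injective]
    · simp
    · intro i j hij
      have hi := hmem i _ (Sym2.mem_mk_left _ _)
      have hj := hmem j _ ((Sym2.ext_iff.1 hij _).1 (Sym2.mem_mk_left _ _))
      exact Fin.ext (hi.symm.trans hj)

end Spider2

/-- **Theorem (higher Steklov eigenvalues).**
For integers `b ≥ k ≥ 3` and `m ≥ 1`, every tree with `b` leaves and matching number `m`
(leaves as boundary) satisfies `σ_k ≤ 1`, and the spider `Sp_{1,b−1;2m−1,1}` is a tree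
with `b` leaves and matching number `m` attaining `σ_k = 1`. -/
theorem steklov_higher_max
    {V : Type*} [Fintype V] (b m k : ℕ) (hk : 3 ≤ k) (hkb : k ≤ b) (hm : 1 ≤ m)
    (T : SimpleGraph V) (hT : T.IsTree)
    (hleaf : (leaves T).ncard = b) (hmatch : matchingNumber T = m) :
    steklovEig T (leaves T) k ≤ 1 ∧
    (spider2 1 (b - 1) (2 * m - 1) 1).IsTree ∧
    (leaves (spider2 1 (b - 1) (2 * m - 1) 1)).ncard = b ∧
    matchingNumber (spider2 1 (b - 1) (2 * m - 1) 1) = m ∧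
    steklovEig (spider2 1 (b - 1) (2 * m - 1) 1)
      (leaves (spider2 1 (b - 1) (2 * m - 1) 1)) k = 1 := by
  have hp : 2 ≤ b - 1 := by omega
  have hℓ : 1 ≤ 2 * m - 1 := by omega
  have hcard : (leaves (spider2 1 (b - 1) (2 * m - 1) 1)).ncard = b := by
    rw [Spider2.ncard_leaves hp hℓ]
    omega
  refine ⟨steklovEig_leaves_le_one hT.connected (by omega) k, Spider2.isTree, hcard,
    Spider2.matchingNumber_eq m hm, le_antisymm ?_ ?_⟩
  · exact steklovEig_leaves_le_one Spider2.isTree.connected (by omega) k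
  · exact one_le_steklovEig_leaves Spider2.isTree.connected
      (Spider2.rank_lapBoundaryBlock_le hp hℓ) hk hk (by omega)

end
end

section
/- Let p1 ≥ 0, p2 ≥ 0 and ℓ1 ≥ ℓ2 ≥ 1 be integers with p1 + p2 ≥ 2, and let T be the spider graph Sp_{p1,p2;ℓ1,ℓ2} with leaves as boundary. Then the Steklov eigenvalues of T are: σ1 = 0; the value 1/ℓ1 with multiplicity p1 − 1 (present only if p1 ≥ 2); the value (p1+p2)/(ℓ2 p1 + ℓ1 p2) with multiplicity 1 (present only if p1 ≥ 1 and p2 ≥ 1); and the value 1/ℓ2 with multiplicity p2 − 1 (present only if p2 ≥ 2). In particular σ2 = … = σ_{p1} = 1/ℓ1, σ_{p1+1} = (p1+p2)/(ℓ2 p1 + ℓ1 p2), and σ_{p1+2} = … = σ_{p1+p2} = 1/ℓ2 when p1, p2 ≥ 1. -/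
open scoped Classical

noncomputable section

/-- The combinatorial Laplacian of a function on the vertices of a graph. -/
def vertexLaplacian {V : Type*} [Fintype V] (G : SimpleGraph V) (h : V → ℝ) (x : V) : ℝ :=
  ∑ y, if G.Adj x y then h x - h y else 0

theorem lapMatrix_mulVec_eq_vertexLaplacian {V : Type*} [Fintype V] (G : SimpleGraph V)
    (h : V → ℝ) (x : V) : (SimpleGraph.lapMatrix ℝ G).mulVec h x = vertexLaplacian G h x := by
  rw [SimpleGraph.lapMatrix_mulVec_apply, vertexLaplacian, ← Finset.sum_filter,
    ← SimpleGraph.neighborFinset_eq_filter, Finset.sum_sub_distrib]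
  simp

theorem vertexLaplacian_eq_sum {V ι : Type*} [Fintype V] (G : SimpleGraph V) (h : V → ℝ) (x : V)
    (s : Finset ι) (φ : ι → V) (hφ : Set.InjOn φ s) (hs : ∀ y, G.Adj x y ↔ ∃ i ∈ s, φ i = y) :
    vertexLaplacian G h x = ∑ i ∈ s, (h x - h (φ i)) := by
  rw [vertexLaplacian, ← Finset.sum_filter,
    ← Finset.sum_image (f := fun y => h x - h y) (g := φ) hφ]
  congr 1
  ext y
  simp [hs]

theorem sum_eq_sum_subtype_add_sum_compl {V : Type*} [Fintype V] (B : Set V) (f : V → ℝ) :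
    ∑ v, f v = ∑ b : B, f b + ∑ i : (Bᶜ : Set V), f i := by
  rw [← Fintype.sum_subtype_add_sum_subtype (fun v => v ∈ B) f]
  rfl

/-- If only the zero function is constant along edges and vanishes on the boundary, the interior
block of the Laplacian is invertible. -/
theorem isUnit_interior_lapMatrix {V : Type*} [Fintype V] (G : SimpleGraph V) (B : Set V)
    (hB : ∀ w : V → ℝ, (∀ x y, G.Adj x y → w x = w y) → (∀ b ∈ B, w b = 0) → w = 0) :
    IsUnit ((SimpleGraph.lapMatrix ℝ G).submatrix (Subtype.val : (Bᶜ : Set V) → V)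
      (Subtype.val : (Bᶜ : Set V) → V)) := by
  rw [← Matrix.mulVec_injective_iff_isUnit, ← Matrix.coe_mulVecLin, ← LinearMap.ker_eq_bot,
    LinearMap.ker_eq_bot']
  intro v hv
  rw [Matrix.mulVecLin_apply] at hv
  let w : V → ℝ := fun x => if hx : x ∈ B then 0 else v ⟨x, hx⟩
  have hwB : ∀ b : B, w b = 0 := fun b => by simp [w]
  have hwI : ∀ i : (Bᶜ : Set V), w i = v i := fun i => by
    have := i.2
    simp only [Set.mem_compl_iff] at this
    simp [w, this]
  have hLw : ∀ i : (Bᶜ : Set V), (SimpleGraph.lapMatrix ℝ G).mulVec w i = 0 := by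
    intro i
    rw [Matrix.mulVec, dotProduct, sum_eq_sum_subtype_add_sum_compl B]
    simp only [hwB, hwI, mul_zero, Finset.sum_const_zero, zero_add]
    exact congrFun hv i
  have hq : Matrix.toLinearMap₂' ℝ (SimpleGraph.lapMatrix ℝ G) w w = 0 := by
    rw [Matrix.toLinearMap₂'_apply', dotProduct, sum_eq_sum_subtype_add_sum_compl B]
    simp [hwB, hLw]
  have hw := hB w ((SimpleGraph.lapMatrix_toLinearMap₂'_apply'_eq_zero_iff_forall_adj ℝ G w).1 hq)
    fun b hb => hwB ⟨b, hb⟩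
  ext i
  rw [← hwI i, hw]
  rfl

theorem steklovMatrix_mulVec {V : Type*} [Fintype V] (G : SimpleGraph V) (B : Set V)
    (hB : ∀ w : V → ℝ, (∀ x y, G.Adj x y → w x = w y) → (∀ b ∈ B, w b = 0) → w = 0)
    (h : V → ℝ) (harm : ∀ x ∉ B, vertexLaplacian G h x = 0) :
    (steklovMatrix G B).mulVec (fun b => h b) = fun b : B => vertexLaplacian G h b := by
  have hu := isUnit_interior_lapMatrix G B hB
  have hL := lapMatrix_mulVec_eq_vertexLaplacian G h
  unfold steklovMatrix
  generalize SimpleGraph.lapMatrix ℝ G = L at hu hL ⊢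
  have split : ∀ x, (∑ b : B, L x b * h b) + (∑ i : (Bᶜ : Set V), L x i * h i)
      = vertexLaplacian G h x := fun x => by
    rw [← hL, Matrix.mulVec, dotProduct, sum_eq_sum_subtype_add_sum_compl B]
  have hI : (L.submatrix (Subtype.val : (Bᶜ : Set V) → V) (Subtype.val : B → V)).mulVec
      (fun b => h b) = (L.submatrix (Subtype.val : (Bᶜ : Set V) → V)
        (Subtype.val : (Bᶜ : Set V) → V)).mulVec (fun i => - h i) := by
    ext i
    have := split i
    rw [harm i i.2] at this
    simp only [Matrix.mulVec, dotProduct, Matrix.submatrix_apply, mul_neg, Finset.sum_neg_distrib]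
    linarith
  dsimp only
  rw [Matrix.sub_mulVec, ← Matrix.mulVec_mulVec, hI, Matrix.mulVec_mulVec, Matrix.mul_assoc,
    Matrix.nonsing_inv_mul _ ((Matrix.isUnit_iff_isUnit_det _).1 hu), Matrix.mul_one]
  ext b
  rw [← split b]
  simp [Matrix.mulVec, dotProduct]

theorem eval_charpoly_diagonal_sub_smul_vecMulVec {K : Type*} [Fintype K] [DecidableEq K]
    (d : K → ℝ) (S x : ℝ) (hx : ∀ k, x ≠ d k) :
    (Matrix.diagonal d - S⁻¹ • Matrix.vecMulVec d d).charpoly.eval x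
      = (∏ k, (x - d k)) * (1 + S⁻¹ * ∑ k, d k ^ 2 / (x - d k)) := by
  have hne : ∀ k, x - d k ≠ 0 := fun k => sub_ne_zero.2 (hx k)
  have hfac : Matrix.scalar K x - (Matrix.diagonal d - S⁻¹ • Matrix.vecMulVec d d)
      = Matrix.diagonal (fun k => x - d k) *
        (1 + Matrix.replicateCol Unit (fun k => S⁻¹ * d k / (x - d k)) *
          Matrix.replicateRow Unit d) := by
    ext i j
    rw [Matrix.diagonal_mul]
    have := hne i
    by_cases hij : i = j
    · subst hij
      simp [Matrix.vecMulVec_apply, Matrix.mul_apply]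
      field_simp
      ring
    · simp [Matrix.vecMulVec_apply, Matrix.mul_apply, hij]
      field_simp
  rw [Matrix.eval_charpoly, hfac, Matrix.det_mul, Matrix.det_diagonal,
    Matrix.det_one_add_replicateCol_mul_replicateRow, dotProduct, Finset.mul_sum]
  congr 2
  refine Finset.sum_congr rfl fun k _ => ?_
  ring

/-- The spectrum of `diag(d) - (∑ d)⁻¹ d dᵀ` when `d` takes two values. -/
theorem roots_charpoly_two_values (p₁ p₂ : ℕ) (a b : ℝ) (ha : 0 < a) (hb : 0 < b)
    (hp : 1 ≤ p₁ + p₂) (d : Fin p₁ ⊕ Fin p₂ → ℝ) (hd : d = Sum.elim (fun _ => a) (fun _ => b)) :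
    (Matrix.diagonal d - (∑ k, d k)⁻¹ • Matrix.vecMulVec d d).charpoly.roots =
      ({0} : Multiset ℝ) + Multiset.replicate (p₁ - 1) a +
        (if 1 ≤ p₁ ∧ 1 ≤ p₂ then
          ({a * b * (p₁ + p₂) / (a * p₁ + b * p₂)} : Multiset ℝ) else 0) +
        Multiset.replicate (p₂ - 1) b := by
  rw [← Polynomial.roots_multiset_prod_X_sub_C (({0} : Multiset ℝ) + _ + _ + _)]
  congr 1
  refine Polynomial.eq_of_infinite_eval_eq _ _ (Set.Infinite.mono (s := {a, b}ᶜ) ?_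
    (Set.Finite.infinite_compl (by simp)))
  intro x hx
  simp only [Set.mem_compl_iff, Set.mem_insert_iff, Set.mem_singleton_iff, not_or] at hx
  have hxa : x - a ≠ 0 := sub_ne_zero.2 hx.1
  have hxb : x - b ≠ 0 := sub_ne_zero.2 hx.2
  rw [Set.mem_ofPred_eq, eval_charpoly_diagonal_sub_smul_vecMulVec _ _ _
    (by subst hd; rintro (k | k); exacts [hx.1, hx.2])]
  subst hd
  simp only [Fintype.prod_sum_type, Fintype.sum_sum_type, Sum.elim_inl, Sum.elim_inr,
    Finset.prod_const, Finset.sum_const, Finset.card_univ, Fintype.card_fin, nsmul_eq_mul,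
    Multiset.map_add, Multiset.prod_add, Multiset.map_singleton, Multiset.prod_singleton,
    Multiset.map_replicate, Multiset.prod_replicate, Polynomial.eval_mul, Polynomial.eval_pow,
    Polynomial.eval_sub, Polynomial.eval_X, Polynomial.eval_C, sub_zero]
  rcases p₁ with _ | m <;> rcases p₂ with _ | n
  · omega
  · have : (n : ℝ) + 1 ≠ 0 := by positivity
    simp
    field_simp
    ring
  · have : (m : ℝ) + 1 ≠ 0 := by positivity
    simp
    field_simp
    ring
  · have : ((m : ℝ) + 1) * a + (n + 1) * b ≠ 0 := by positivity
    have : a * ((m : ℝ) + 1) + b * (n + 1) ≠ 0 := by positivity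
    simp
    field_simp
    ring

/-- The length of a leg of the two-length spider. -/
def legLength {p₁ p₂ : ℕ} (ℓ₁ ℓ₂ : ℕ) : Fin p₁ ⊕ Fin p₂ → ℕ :=
  Sum.elim (fun _ => ℓ₁) (fun _ => ℓ₂)

/-- The vertex at distance `j` from the center on a given leg of the two-length spider. -/
def legVertex {p₁ p₂ : ℕ} (ℓ₁ ℓ₂ : ℕ) : Fin p₁ ⊕ Fin p₂ → ℕ → Spider2V p₁ p₂ ℓ₁ ℓ₂
  | _, 0 => none
  | Sum.inl i, j + 1 => if h : j < ℓ₁ then some (Sum.inl (i, ⟨j, h⟩)) else none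
  | Sum.inr i, j + 1 => if h : j < ℓ₂ then some (Sum.inr (i, ⟨j, h⟩)) else none

section Spider

variable {p₁ p₂ ℓ₁ ℓ₂ : ℕ}

theorem legVertex_zero (s : Fin p₁ ⊕ Fin p₂) : legVertex ℓ₁ ℓ₂ s 0 = none := by
  rcases s with s | s <;> rfl

theorem eq_none_or_exists_legVertex (v : Spider2V p₁ p₂ ℓ₁ ℓ₂) :
    v = none ∨ ∃ s j, j < legLength ℓ₁ ℓ₂ s ∧ v = legVertex ℓ₁ ℓ₂ s (j + 1) := by
  rcases v with _ | ⟨i, j, hj⟩ | ⟨i, j, hj⟩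
  · exact Or.inl rfl
  · exact Or.inr ⟨Sum.inl i, j, hj, by simp [legVertex, hj]⟩
  · exact Or.inr ⟨Sum.inr i, j, hj, by simp [legVertex, hj]⟩

theorem legVertex_succ_ne_none {s : Fin p₁ ⊕ Fin p₂} {j : ℕ} (hj : j < legLength ℓ₁ ℓ₂ s) :
    legVertex ℓ₁ ℓ₂ s (j + 1) ≠ none := by
  rcases s with s | s <;> simp [legLength] at hj <;> simp [legVertex, hj]

theorem legVertex_succ_inj {s t : Fin p₁ ⊕ Fin p₂} {j k : ℕ} (hj : j < legLength ℓ₁ ℓ₂ s)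
    (hk : k < legLength ℓ₁ ℓ₂ t) :
    legVertex ℓ₁ ℓ₂ s (j + 1) = legVertex ℓ₁ ℓ₂ t (k + 1) ↔ s = t ∧ j = k := by
  rcases s with s | s <;> rcases t with t | t <;> simp [legLength] at hj hk <;>
    simp [legVertex, hj, hk]

theorem spider2_adj_none (hℓ₁ : 0 < ℓ₁) (hℓ₂ : 0 < ℓ₂) (y : Spider2V p₁ p₂ ℓ₁ ℓ₂) :
    (spider2 p₁ p₂ ℓ₁ ℓ₂).Adj none y ↔ ∃ s, legVertex ℓ₁ ℓ₂ s 1 = y := by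
  rcases y with _ | ⟨i, j, hj⟩ | ⟨i, j, hj⟩ <;>
    simp [spider2, spider2Rel, legVertex, hℓ₁, hℓ₂, eq_comm]

theorem spider2_adj_legVertex {s : Fin p₁ ⊕ Fin p₂} {j : ℕ} (hj : j < legLength ℓ₁ ℓ₂ s)
    (y : Spider2V p₁ p₂ ℓ₁ ℓ₂) :
    (spider2 p₁ p₂ ℓ₁ ℓ₂).Adj (legVertex ℓ₁ ℓ₂ s (j + 1)) y ↔
      legVertex ℓ₁ ℓ₂ s j = y ∨
        (j + 1 < legLength ℓ₁ ℓ₂ s ∧ legVertex ℓ₁ ℓ₂ s (j + 2) = y) := by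
  rcases s with s | s <;> simp only [legLength, Sum.elim_inl, Sum.elim_inr] at hj ⊢ <;>
    rcases y with _ | ⟨i, k, hk⟩ | ⟨i, k, hk⟩ <;> rcases j with _ | j <;>
    simp only [spider2, SimpleGraph.fromRel_adj, spider2Rel, legVertex, hj, dif_pos] <;>
    grind

theorem legLength_pos (hℓ₁ : 0 < ℓ₁) (hℓ₂ : 0 < ℓ₂) (s : Fin p₁ ⊕ Fin p₂) :
    0 < legLength ℓ₁ ℓ₂ s := by
  rcases s with s | s <;> assumption

theorem legVertex_succ_mem_leaves_iff {s : Fin p₁ ⊕ Fin p₂} {j : ℕ}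
    (hj : j < legLength ℓ₁ ℓ₂ s) :
    legVertex ℓ₁ ℓ₂ s (j + 1) ∈ leaves (spider2 p₁ p₂ ℓ₁ ℓ₂) ↔ j + 1 = legLength ℓ₁ ℓ₂ s := by
  have hset : (spider2 p₁ p₂ ℓ₁ ℓ₂).neighborSet (legVertex ℓ₁ ℓ₂ s (j + 1)) =
      {y | legVertex ℓ₁ ℓ₂ s j = y ∨
        (j + 1 < legLength ℓ₁ ℓ₂ s ∧ legVertex ℓ₁ ℓ₂ s (j + 2) = y)} :=
    Set.ext fun y => spider2_adj_legVertex hj y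
  rw [leaves, Set.mem_ofPred_eq, hset]
  by_cases h : j + 1 < legLength ℓ₁ ℓ₂ s
  · have hne : legVertex ℓ₁ ℓ₂ s j ≠ legVertex ℓ₁ ℓ₂ s (j + 2) := by
      rcases j with _ | j
      · rw [legVertex_zero]
        exact (legVertex_succ_ne_none h).symm
      · rw [Ne, legVertex_succ_inj (by omega) h]
        omega
    have : {y | legVertex ℓ₁ ℓ₂ s j = y ∨
        (j + 1 < legLength ℓ₁ ℓ₂ s ∧ legVertex ℓ₁ ℓ₂ s (j + 2) = y)} =
        {legVertex ℓ₁ ℓ₂ s j, legVertex ℓ₁ ℓ₂ s (j + 2)} := by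
      ext y
      simp [h, eq_comm]
    rw [this, Set.ncard_pair hne]
    omega
  · simp only [h, false_and, or_false, Set.ofPred_eq_eq_singleton', Set.ncard_singleton,
      true_iff]
    omega

theorem none_notMem_leaves (hℓ₁ : 0 < ℓ₁) (hℓ₂ : 0 < ℓ₂) (hp : 2 ≤ p₁ + p₂) :
    none ∉ leaves (spider2 p₁ p₂ ℓ₁ ℓ₂) := by
  have hset : (spider2 p₁ p₂ ℓ₁ ℓ₂).neighborSet none =
      (fun s : Fin p₁ ⊕ Fin p₂ => legVertex ℓ₁ ℓ₂ s 1) '' Set.univ :=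
    Set.ext fun y => by simpa using spider2_adj_none hℓ₁ hℓ₂ y
  have hpos := legLength_pos (p₁ := p₁) (p₂ := p₂) hℓ₁ hℓ₂
  rw [leaves, Set.mem_ofPred_eq, hset, Set.ncard_image_of_injective _ fun s t hst =>
    ((legVertex_succ_inj (hpos s) (hpos t)).1 hst).1]
  simp [Set.ncard_univ]
  omega

/-- The leaves of the two-length spider are the ends of its legs. -/
def leafEquiv (hℓ₁ : 0 < ℓ₁) (hℓ₂ : 0 < ℓ₂) (hp : 2 ≤ p₁ + p₂) :
    Fin p₁ ⊕ Fin p₂ ≃ leaves (spider2 p₁ p₂ ℓ₁ ℓ₂) :=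
  Equiv.ofBijective
    (fun s => ⟨legVertex ℓ₁ ℓ₂ s (legLength ℓ₁ ℓ₂ s - 1 + 1),
      (legVertex_succ_mem_leaves_iff (by have := legLength_pos hℓ₁ hℓ₂ s; omega)).2
        (by have := legLength_pos hℓ₁ hℓ₂ s; omega)⟩)
    (by
      have hpos := legLength_pos (p₁ := p₁) (p₂ := p₂) hℓ₁ hℓ₂
      constructor
      · intro s t hst
        exact ((legVertex_succ_inj (Nat.sub_lt (hpos s) one_pos) (Nat.sub_lt (hpos t) one_pos)).1
          (Subtype.ext_iff.1 hst)).1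
      · rintro ⟨v, hv⟩
        rcases eq_none_or_exists_legVertex v with rfl | ⟨s, j, hj, rfl⟩
        · exact absurd hv (none_notMem_leaves hℓ₁ hℓ₂ hp)
        · refine ⟨s, Subtype.ext ?_⟩
          have := (legVertex_succ_mem_leaves_iff hj).1 hv
          simp only [← this, Nat.add_sub_cancel])

theorem leafEquiv_apply (hℓ₁ : 0 < ℓ₁) (hℓ₂ : 0 < ℓ₂) (hp : 2 ≤ p₁ + p₂)
    (s : Fin p₁ ⊕ Fin p₂) :
    (leafEquiv hℓ₁ hℓ₂ hp s : Spider2V p₁ p₂ ℓ₁ ℓ₂) = legVertex ℓ₁ ℓ₂ s (legLength ℓ₁ ℓ₂ s) := by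
  have := legLength_pos hℓ₁ hℓ₂ s
  change legVertex ℓ₁ ℓ₂ s (legLength ℓ₁ ℓ₂ s - 1 + 1) = _
  rw [Nat.sub_add_cancel this]

theorem eq_zero_of_forall_adj_of_leaves (hℓ₁ : 0 < ℓ₁) (hℓ₂ : 0 < ℓ₂) (hp : 2 ≤ p₁ + p₂)
    (w : Spider2V p₁ p₂ ℓ₁ ℓ₂ → ℝ)
    (hadj : ∀ x y, (spider2 p₁ p₂ ℓ₁ ℓ₂).Adj x y → w x = w y)
    (hw : ∀ b ∈ leaves (spider2 p₁ p₂ ℓ₁ ℓ₂), w b = 0) : w = 0 := by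
  have hleg : ∀ s j, j ≤ legLength ℓ₁ ℓ₂ s → w (legVertex ℓ₁ ℓ₂ s j) = w none := by
    intro s j
    induction j with
    | zero => intro _; rw [legVertex_zero]
    | succ j ih =>
      intro hj
      rw [← ih (by omega)]
      exact hadj _ _ ((spider2_adj_legVertex (by omega) _).2 (Or.inl rfl))
  have hnone : w none = 0 := by
    have s : Fin p₁ ⊕ Fin p₂ := finSumFinEquiv.symm ⟨0, by omega⟩
    rw [← hleg s _ le_rfl, ← leafEquiv_apply hℓ₁ hℓ₂ hp]
    exact hw _ (leafEquiv hℓ₁ hℓ₂ hp s).2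
  funext v
  rcases eq_none_or_exists_legVertex v with rfl | ⟨s, j, hj, rfl⟩
  · exact hnone
  · rw [hleg s _ hj, hnone, Pi.zero_apply]

/-- The function on the two-length spider which equals `c` at the center, `f s` at the end of
the leg `s`, and is affine along each leg. -/
def affineExtension (c : ℝ) (f : Fin p₁ ⊕ Fin p₂ → ℝ) : Spider2V p₁ p₂ ℓ₁ ℓ₂ → ℝ
  | none => c
  | some (Sum.inl (i, j)) => c + (j + 1) / ℓ₁ * (f (Sum.inl i) - c)
  | some (Sum.inr (i, j)) => c + (j + 1) / ℓ₂ * (f (Sum.inr i) - c)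

theorem affineExtension_legVertex (c : ℝ) (f : Fin p₁ ⊕ Fin p₂ → ℝ) (s : Fin p₁ ⊕ Fin p₂) {j : ℕ}
    (hj : j ≤ legLength ℓ₁ ℓ₂ s) :
    affineExtension c f (legVertex ℓ₁ ℓ₂ s j) = c + j / legLength ℓ₁ ℓ₂ s * (f s - c) := by
  rcases j with _ | j
  · simp [legVertex_zero, affineExtension]
  · rcases s with s | s <;> simp only [legLength, Sum.elim_inl, Sum.elim_inr] at hj ⊢ <;>
      simp [legVertex, affineExtension, Nat.lt_of_succ_le hj]

theorem vertexLaplacian_affineExtension_none (hℓ₁ : 0 < ℓ₁) (hℓ₂ : 0 < ℓ₂) (c : ℝ)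
    (f : Fin p₁ ⊕ Fin p₂ → ℝ) :
    vertexLaplacian (spider2 p₁ p₂ ℓ₁ ℓ₂) (affineExtension c f) none =
      ∑ s, (c - f s) / legLength ℓ₁ ℓ₂ s := by
  have hpos := legLength_pos (p₁ := p₁) (p₂ := p₂) hℓ₁ hℓ₂
  rw [vertexLaplacian_eq_sum _ _ _ Finset.univ
    (fun s : Fin p₁ ⊕ Fin p₂ => legVertex ℓ₁ ℓ₂ s 1)
    (fun s _ t _ hst => ((legVertex_succ_inj (hpos s) (hpos t)).1 hst).1)
    (by simpa using spider2_adj_none hℓ₁ hℓ₂)]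
  refine Finset.sum_congr rfl fun s _ => ?_
  rw [affineExtension_legVertex c f s (hpos s), affineExtension]
  push_cast
  ring

theorem vertexLaplacian_affineExtension_interior (c : ℝ) (f : Fin p₁ ⊕ Fin p₂ → ℝ)
    {s : Fin p₁ ⊕ Fin p₂} {j : ℕ} (hj : j + 1 < legLength ℓ₁ ℓ₂ s) :
    vertexLaplacian (spider2 p₁ p₂ ℓ₁ ℓ₂) (affineExtension c f) (legVertex ℓ₁ ℓ₂ s (j + 1)) =
      0 := by
  have hne : legVertex ℓ₁ ℓ₂ s j ≠ legVertex ℓ₁ ℓ₂ s (j + 2) := by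
    rcases j with _ | j
    · rw [legVertex_zero]
      exact (legVertex_succ_ne_none hj).symm
    · rw [Ne, legVertex_succ_inj (by omega) hj]
      omega
  rw [vertexLaplacian_eq_sum _ _ _ {legVertex ℓ₁ ℓ₂ s j, legVertex ℓ₁ ℓ₂ s (j + 2)} id
    Function.injective_id.injOn
    (fun y => by rw [spider2_adj_legVertex (by omega)]; simp [hj, eq_comm]),
    Finset.sum_pair hne]
  simp only [id]
  rw [affineExtension_legVertex c f s (by omega), affineExtension_legVertex c f s (by omega),
    affineExtension_legVertex c f s (by omega)]
  push_cast
  ring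

theorem vertexLaplacian_affineExtension_leaf (hℓ₁ : 0 < ℓ₁) (hℓ₂ : 0 < ℓ₂) (c : ℝ)
    (f : Fin p₁ ⊕ Fin p₂ → ℝ) (s : Fin p₁ ⊕ Fin p₂) :
    vertexLaplacian (spider2 p₁ p₂ ℓ₁ ℓ₂) (affineExtension c f)
      (legVertex ℓ₁ ℓ₂ s (legLength ℓ₁ ℓ₂ s)) = (f s - c) / legLength ℓ₁ ℓ₂ s := by
  obtain ⟨j, hj⟩ := Nat.exists_eq_add_of_lt (legLength_pos hℓ₁ hℓ₂ s)
  rw [zero_add] at hj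
  have hlt : j < legLength ℓ₁ ℓ₂ s := by omega
  conv_lhs => rw [hj]
  rw [vertexLaplacian_eq_sum _ _ _ {legVertex ℓ₁ ℓ₂ s j} id
    Function.injective_id.injOn
    (fun y => by rw [spider2_adj_legVertex hlt]; simp [hj, eq_comm]), Finset.sum_singleton]
  simp only [id]
  rw [affineExtension_legVertex c f s hlt, affineExtension_legVertex c f s hlt.le]
  push_cast
  ring

/-- Up to the labelling of the leaves, the Steklov matrix of a two-length spider is the difference
of a diagonal matrix and a rank-one matrix. -/
theorem steklovMatrix_spider2 (hℓ₁ : 0 < ℓ₁) (hℓ₂ : 0 < ℓ₂) (hp : 2 ≤ p₁ + p₂)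
    (d : Fin p₁ ⊕ Fin p₂ → ℝ) (hd : ∀ s, d s = 1 / legLength ℓ₁ ℓ₂ s) :
    (steklovMatrix (spider2 p₁ p₂ ℓ₁ ℓ₂) (leaves (spider2 p₁ p₂ ℓ₁ ℓ₂))).submatrix
        (leafEquiv hℓ₁ hℓ₂ hp) (leafEquiv hℓ₁ hℓ₂ hp) =
      Matrix.diagonal d - (∑ s, d s)⁻¹ • Matrix.vecMulVec d d := by
  have hpos := legLength_pos (p₁ := p₁) (p₂ := p₂) hℓ₁ hℓ₂
  have hdpos : ∀ s, 0 < d s := fun s => by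
    rw [hd]
    exact one_div_pos.2 (Nat.cast_pos.2 (hpos s))
  have hS : ∑ s, d s ≠ 0 :=
    (Finset.sum_pos (fun s _ => hdpos s) ⟨finSumFinEquiv.symm ⟨0, by omega⟩, by simp⟩).ne'
  refine Matrix.mulVec_injective (funext fun f => ?_)
  set c : ℝ := (∑ s, d s)⁻¹ * ∑ s, d s * f s with hc
  have hend : ∀ s, affineExtension c f (leafEquiv hℓ₁ hℓ₂ hp s : Spider2V p₁ p₂ ℓ₁ ℓ₂) = f s := by
    intro s
    have : (legLength ℓ₁ ℓ₂ s : ℝ) ≠ 0 := (Nat.cast_pos.2 (hpos s)).ne'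
    rw [leafEquiv_apply, affineExtension_legVertex c f s le_rfl, div_self this]
    ring
  have key := steklovMatrix_mulVec (spider2 p₁ p₂ ℓ₁ ℓ₂) (leaves (spider2 p₁ p₂ ℓ₁ ℓ₂))
    (eq_zero_of_forall_adj_of_leaves hℓ₁ hℓ₂ hp) (affineExtension c f) (by
      intro x hx
      rcases eq_none_or_exists_legVertex x with rfl | ⟨s, j, hj, rfl⟩
      · rw [vertexLaplacian_affineExtension_none hℓ₁ hℓ₂]
        have : ∀ s, (c - f s) / legLength ℓ₁ ℓ₂ s = d s * c - d s * f s := fun s => by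
          rw [hd]
          ring
        simp only [this, Finset.sum_sub_distrib, ← Finset.sum_mul]
        rw [hc, mul_inv_cancel_left₀ hS, sub_self]
      · rw [legVertex_succ_mem_leaves_iff hj] at hx
        exact vertexLaplacian_affineExtension_interior c f (by omega))
  rw [Matrix.submatrix_mulVec_equiv]
  have hf : f ∘ (leafEquiv hℓ₁ hℓ₂ hp).symm = fun b : leaves (spider2 p₁ p₂ ℓ₁ ℓ₂) =>
      affineExtension c f (b : Spider2V p₁ p₂ ℓ₁ ℓ₂) := by
    funext b
    obtain ⟨s, rfl⟩ := (leafEquiv hℓ₁ hℓ₂ hp).surjective b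
    rw [hend, Function.comp_apply, Equiv.symm_apply_apply]
  rw [hf, key]
  funext s
  rw [Function.comp_apply, leafEquiv_apply, vertexLaplacian_affineExtension_leaf hℓ₁ hℓ₂,
    Matrix.sub_mulVec, Matrix.smul_mulVec, Matrix.vecMulVec_mulVec]
  simp only [Pi.sub_apply, Matrix.mulVec_diagonal, Pi.smul_apply, smul_eq_mul, dotProduct,
    op_smul_eq_smul]
  rw [hc, hd s]
  ring

end Spider

theorem sort_roots_eq (m n : ℕ) (a c b : ℝ) (l : List ℝ) (ha : 0 ≤ a)
    (hac : a ≤ c) (hcb : c ≤ b) (hl : l.Sublist [c]) :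
    (({0} : Multiset ℝ) + Multiset.replicate m a + (l : Multiset ℝ) +
      Multiset.replicate n b).sort (· ≤ ·) =
      0 :: (List.replicate m a ++ (l ++ List.replicate n b)) := by
  have hcoe : (({0} : Multiset ℝ) + Multiset.replicate m a + (l : Multiset ℝ) +
      Multiset.replicate n b) =
      ((0 :: (List.replicate m a ++ (l ++ List.replicate n b)) : List ℝ) : Multiset ℝ) := by
    simp [← Multiset.coe_replicate, ← Multiset.coe_add, ← Multiset.cons_coe, add_assoc,
      ← Multiset.singleton_add]
  have hmem : ∀ x ∈ l, x = c := fun x hx => by simpa using hl.subset hx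
  refine List.Perm.eq_of_pairwise' (Multiset.pairwise_sort _ _) ?_
    (Multiset.coe_eq_coe.1 (by rw [Multiset.sort_eq, hcoe]))
  simp only [List.pairwise_cons, List.pairwise_append, List.mem_append, List.mem_replicate,
    List.pairwise_replicate]
  have : l.Pairwise (· ≤ ·) := (List.pairwise_singleton _ c).sublist hl
  grind

/-- **Lemma (Steklov spectrum of two-length spiders).**
For the spider `Sp_{p₁,p₂;ℓ₁,ℓ₂}` (with `p₁+p₂ ≥ 2`, `ℓ₁ ≥ ℓ₂ ≥ 1`) with leaves as
boundary, the Steklov spectrum (as a multiset, i.e. roots of the characteristic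
polynomial of the Steklov matrix) consists of `0`, the value `1/ℓ₁` with multiplicity
`p₁ − 1`, the value `(p₁+p₂)/(ℓ₂p₁+ℓ₁p₂)` (present exactly when `p₁, p₂ ≥ 1`), and the
value `1/ℓ₂` with multiplicity `p₂ − 1`.  In particular, when `p₁, p₂ ≥ 1`:
`σ₂ = ⋯ = σ_{p₁} = 1/ℓ₁`, `σ_{p₁+1} = (p₁+p₂)/(ℓ₂p₁+ℓ₁p₂)`, and
`σ_{p₁+2} = ⋯ = σ_{p₁+p₂} = 1/ℓ₂`. -/
theorem steklov_spectrum_spider2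
    (p₁ p₂ ℓ₁ ℓ₂ : ℕ) (hℓ₂ : 1 ≤ ℓ₂) (hℓ : ℓ₂ ≤ ℓ₁) (hp : 2 ≤ p₁ + p₂) :
    (steklovMatrix (spider2 p₁ p₂ ℓ₁ ℓ₂) (leaves (spider2 p₁ p₂ ℓ₁ ℓ₂))).charpoly.roots =
      ({0} : Multiset ℝ) + Multiset.replicate (p₁ - 1) (1 / (ℓ₁ : ℝ)) +
        (if 1 ≤ p₁ ∧ 1 ≤ p₂ then
          ({((p₁ : ℝ) + p₂) / ((ℓ₂ : ℝ) * p₁ + (ℓ₁ : ℝ) * p₂)} : Multiset ℝ) else 0) +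
        Multiset.replicate (p₂ - 1) (1 / (ℓ₂ : ℝ)) ∧
    steklovEig (spider2 p₁ p₂ ℓ₁ ℓ₂) (leaves (spider2 p₁ p₂ ℓ₁ ℓ₂)) 1 = 0 ∧
    (1 ≤ p₁ → 1 ≤ p₂ →
      (∀ k : ℕ, 2 ≤ k → k ≤ p₁ →
        steklovEig (spider2 p₁ p₂ ℓ₁ ℓ₂) (leaves (spider2 p₁ p₂ ℓ₁ ℓ₂)) k = 1 / (ℓ₁ : ℝ)) ∧
      steklovEig (spider2 p₁ p₂ ℓ₁ ℓ₂) (leaves (spider2 p₁ p₂ ℓ₁ ℓ₂)) (p₁ + 1)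
        = ((p₁ : ℝ) + p₂) / ((ℓ₂ : ℝ) * p₁ + (ℓ₁ : ℝ) * p₂) ∧
      (∀ k : ℕ, p₁ + 2 ≤ k → k ≤ p₁ + p₂ →
        steklovEig (spider2 p₁ p₂ ℓ₁ ℓ₂) (leaves (spider2 p₁ p₂ ℓ₁ ℓ₂)) k = 1 / (ℓ₂ : ℝ))) := by
  have hℓ₁ : 1 ≤ ℓ₁ := hℓ₂.trans hℓ
  have hb₁ : (0 : ℝ) < ℓ₁ := Nat.cast_pos.2 hℓ₁
  have hb₂ : (0 : ℝ) < ℓ₂ := Nat.cast_pos.2 hℓ₂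
  have hb : (ℓ₂ : ℝ) ≤ ℓ₁ := Nat.cast_le.2 hℓ
  have hroots : (steklovMatrix (spider2 p₁ p₂ ℓ₁ ℓ₂)
      (leaves (spider2 p₁ p₂ ℓ₁ ℓ₂))).charpoly.roots =
      ({0} : Multiset ℝ) + Multiset.replicate (p₁ - 1) (1 / (ℓ₁ : ℝ)) +
        (if 1 ≤ p₁ ∧ 1 ≤ p₂ then
          ({((p₁ : ℝ) + p₂) / ((ℓ₂ : ℝ) * p₁ + (ℓ₁ : ℝ) * p₂)} : Multiset ℝ) else 0) +
        Multiset.replicate (p₂ - 1) (1 / (ℓ₂ : ℝ)) := by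
    have hval : 1 / (ℓ₁ : ℝ) * (1 / ℓ₂) * (p₁ + p₂) / (1 / ℓ₁ * p₁ + 1 / ℓ₂ * p₂) =
        ((p₁ : ℝ) + p₂) / ((ℓ₂ : ℝ) * p₁ + (ℓ₁ : ℝ) * p₂) := by
      have : 1 / (ℓ₁ : ℝ) * p₁ + 1 / ℓ₂ * p₂ = 1 / (ℓ₁ : ℝ) * (1 / ℓ₂) * (ℓ₂ * p₁ + ℓ₁ * p₂) := by
        field_simp
      rw [this, mul_div_mul_left]
      positivity
    rw [← hval, ← roots_charpoly_two_values p₁ p₂ (1 / ℓ₁) (1 / ℓ₂) (by positivity)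
      (by positivity) (by omega) _ rfl, ← steklovMatrix_spider2 hℓ₁ hℓ₂ hp _
      (by rintro (s | s) <;> rfl),
      ← Matrix.charpoly_reindex (leafEquiv hℓ₁ hℓ₂ hp).symm]
    simp only [Matrix.reindex_apply, Equiv.symm_symm]
  have hlist : ∃ l : List ℝ, l.Sublist [((p₁ : ℝ) + p₂) / ((ℓ₂ : ℝ) * p₁ + (ℓ₁ : ℝ) * p₂)] ∧
      (l : Multiset ℝ) = (if 1 ≤ p₁ ∧ 1 ≤ p₂ then
          ({((p₁ : ℝ) + p₂) / ((ℓ₂ : ℝ) * p₁ + (ℓ₁ : ℝ) * p₂)} : Multiset ℝ) else 0) ∧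
      (1 ≤ p₁ → 1 ≤ p₂ → l = [((p₁ : ℝ) + p₂) / ((ℓ₂ : ℝ) * p₁ + (ℓ₁ : ℝ) * p₂)]) := by
    by_cases h : 1 ≤ p₁ ∧ 1 ≤ p₂
    · exact ⟨_, List.Sublist.refl _, by simp [h], fun _ _ => rfl⟩
    · exact ⟨[], List.nil_sublist _, by simp [h], fun h₁ h₂ => absurd ⟨h₁, h₂⟩ h⟩
  obtain ⟨l, hl, hlcoe, hleq⟩ := hlist
  have hsum : (0 : ℝ) < p₁ + p₂ := by
    exact_mod_cast (by omega : 0 < p₁ + p₂)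
  have hden : 0 < (ℓ₂ : ℝ) * p₁ + ℓ₁ * p₂ := by
    nlinarith [mul_le_mul_of_nonneg_right hb (Nat.cast_nonneg (α := ℝ) p₂), mul_pos hb₂ hsum]
  have heig : ∀ k, steklovEig (spider2 p₁ p₂ ℓ₁ ℓ₂) (leaves (spider2 p₁ p₂ ℓ₁ ℓ₂)) k =
      (0 :: (List.replicate (p₁ - 1) (1 / (ℓ₁ : ℝ)) ++
        (l ++ List.replicate (p₂ - 1) (1 / (ℓ₂ : ℝ))))).getD (k - 1) 0 := by
    intro k
    have hsort : steklovEig (spider2 p₁ p₂ ℓ₁ ℓ₂) (leaves (spider2 p₁ p₂ ℓ₁ ℓ₂)) k =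
        ((steklovMatrix (spider2 p₁ p₂ ℓ₁ ℓ₂)
          (leaves (spider2 p₁ p₂ ℓ₁ ℓ₂))).charpoly.roots.sort (· ≤ ·)).getD (k - 1) 0 := by
      unfold steklovEig kthEig
      congr!
    rw [hsort, hroots, ← hlcoe, sort_roots_eq _ _ _ _ _ _ (by positivity) ?_ ?_ hl]
    · rw [div_le_div_iff₀ hb₁ hden]
      nlinarith [mul_le_mul_of_nonneg_right hb (Nat.cast_nonneg (α := ℝ) p₁)]
    · rw [div_le_div_iff₀ hden hb₂]
      nlinarith [mul_le_mul_of_nonneg_right hb (Nat.cast_nonneg (α := ℝ) p₂)]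
  refine ⟨hroots, by simp [heig], fun h₁ h₂ => ⟨fun k hk hk' => ?_, ?_, fun k hk hk' => ?_⟩⟩ <;>
    rw [heig, hleq h₁ h₂]
  · obtain ⟨k, rfl⟩ := Nat.exists_eq_add_of_le' hk
    rw [show k + 2 - 1 = k + 1 by omega, List.getD_cons_succ,
      List.getD_append _ _ _ _ (by simp; omega),
      List.getD_replicate _ (by omega)]
  · obtain ⟨q, rfl⟩ := Nat.exists_eq_add_of_le' h₁
    rw [Nat.add_sub_cancel, Nat.add_sub_cancel, List.getD_cons_succ, List.getD_append_right _ _ _ _ (by simp)]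
    simp
  · obtain ⟨q, rfl⟩ := Nat.exists_eq_add_of_le' h₁
    obtain ⟨k, rfl⟩ := Nat.exists_eq_add_of_le' hk
    rw [show k + (q + 1 + 2) - 1 = (k + q + 1) + 1 by omega, List.getD_cons_succ,
      List.getD_append_right _ _ _ _ (by simp; omega),
      List.getD_append_right _ _ _ _ (by simp; omega), List.getD_replicate]
    simp
    omega

end
end

section
/- Let b ≥ 3 and t ≥ 1 be integers. If T is a tree with b leaves and diameter at most 4t, then the matching number of T is at most bt. -/
open scoped Classical

noncomputable section

namespace SimpleGraph

variable {V : Type*} {T : SimpleGraph V}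

theorem IsAcyclic.eq_of_isPath (hT : T.IsAcyclic) {u v : V} {p q : T.Walk u v}
    (hp : p.IsPath) (hq : q.IsPath) : p = q :=
  congrArg Subtype.val ((hT.subsingleton_path u v).elim ⟨p, hp⟩ ⟨q, hq⟩)

theorem Walk.dist_add_dist_le_of_mem_support {G : SimpleGraph V} {u v w : V} (p : G.Walk u v)
    (hw : w ∈ p.support) : G.dist u w + G.dist w v ≤ p.length := by
  have h := congrArg Walk.length (p.take_spec hw)
  rw [Walk.length_append] at h
  rw [← h]
  exact Nat.add_le_add (dist_le _) (dist_le _)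

/-- A tree of diameter at most `2 * r` has a vertex of eccentricity at most `r`. -/
theorem IsTree.exists_forall_dist_le [Finite V] (hT : T.IsTree) {r : ℕ}
    (hdiam : T.diam ≤ 2 * r) : ∃ c, ∀ w, T.dist c w ≤ r := by
  have hc := hT.connected
  have := hc.nonempty
  have hle (x y : V) : T.dist x y ≤ T.diam :=
    dist_le_diam (connected_iff_ediam_ne_top.mp hc)
  obtain ⟨u, v, huv⟩ := T.exists_dist_eq_diam
  obtain ⟨p, hp, hpl⟩ := hc.exists_path_of_dist u v
  by_cases hr : T.diam ≤ r
  · exact ⟨u, fun w => (hle u w).trans hr⟩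
  have hmem := p.getVert_mem_support r
  have h1 : T.dist u (p.getVert r) ≤ r := by
    refine (dist_le (p.take r)).trans ?_
    rw [Walk.take_length]
    omega
  have h2 : T.dist (p.getVert r) v ≤ T.diam - r := by
    refine (dist_le (p.drop r)).trans ?_
    rw [Walk.drop_length]
    omega
  have h3 := hc.dist_triangle (u := u) (v := p.getVert r) (w := v)
  refine ⟨p.getVert r, fun w => ?_⟩
  generalize p.getVert r = c at *
  obtain ⟨q, -, hq⟩ := hc.exists_path_of_dist u w
  obtain ⟨q', -, hq'⟩ := hc.exists_path_of_dist w v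
  have hsub : c ∈ (q.append q').support := by
    apply (q.append q').support_bypass_subset_support
    rwa [hT.isAcyclic.eq_of_isPath (q.append q').bypass_isPath hp]
  have := hle u w
  have := hle w v
  rcases (Walk.mem_support_append_iff _ _).mp hsub with h | h
  · have := q.dist_add_dist_le_of_mem_support h
    omega
  · have := q'.dist_add_dist_le_of_mem_support h
    rw [dist_comm (u := w)] at this
    omega

/-- In a finite tree, every vertex `v ≠ c` lies on a path from `c` to a leaf. -/
theorem IsTree.exists_leaf_isPath_mem_support [Finite V] (hT : T.IsTree) {c v : V}
    (hv : v ≠ c) : ∃ l ∈ leaves T, ∃ p : T.Walk c l, p.IsPath ∧ v ∈ p.support := by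
  choose P hP using fun x => hT.connected.exists_isPath c x
  obtain ⟨x, hx, hmax⟩ := Set.exists_max_image {x | v ∈ (P x).support} (fun x => (P x).length)
    (Set.toFinite _) ⟨v, (P v).end_mem_support⟩
  refine ⟨x, Set.ncard_eq_one.mpr ⟨(P x).penultimate, ?_⟩, P x, hP x, hx⟩
  have hnil : ¬ (P x).Nil := by
    intro hn
    rw [Set.mem_ofPred_eq, Walk.nil_iff_support_eq.mp hn, List.mem_singleton] at hx
    exact hv hx
  ext y
  rw [mem_neighborSet, Set.mem_singleton_iff]
  refine ⟨fun hy => ?_, ?_⟩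
  · by_cases hmem : y ∈ (P x).support
    · exact hT.isAcyclic.eq_penultimate_of_adj_end (hP x) hy hmem
    · have heq := hT.isAcyclic.eq_of_isPath ((hP x).concat hmem hy) (hP y)
      have := hmax y (by
        rw [Set.mem_ofPred_eq, ← heq, Walk.support_concat]
        exact List.mem_append_left _ hx)
      rw [← heq, Walk.length_concat] at this
      omega
  · rintro rfl
    exact ((P x).adj_penultimate hnil).symm

/-- A tree of radius at most `r` is covered by the paths from its centre to its leaves, so it has
at most `r * #leaves + 1` vertices. -/
theorem IsTree.card_le_ncard_leaves_mul_add_one [Fintype V] (hT : T.IsTree) {c : V} {r : ℕ}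
    (hr : ∀ w, T.dist c w ≤ r) : Fintype.card V ≤ (leaves T).ncard * r + 1 := by
  choose P hP hPl using fun x => hT.connected.exists_path_of_dist c x
  have hcover : (Finset.univ.erase c : Finset V) ⊆
      (leaves T).toFinset.biUnion fun l => (P l).support.tail.toFinset := by
    intro v hv
    obtain ⟨l, hl, p, hp, hvp⟩ :=
      hT.exists_leaf_isPath_mem_support (Finset.ne_of_mem_erase hv)
    rw [hT.isAcyclic.eq_of_isPath hp (hP l), Walk.mem_support_iff] at hvp
    simp only [Finset.mem_biUnion, Set.mem_toFinset, List.mem_toFinset]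
    exact ⟨l, hl, hvp.resolve_left (Finset.ne_of_mem_erase hv)⟩
  have h := (Finset.card_le_card hcover).trans (Finset.card_biUnion_le_card_mul _ _ r fun l _ =>
    (List.toFinset_card_le _).trans (by simpa [hPl] using hr l))
  rw [Finset.card_erase_of_mem (Finset.mem_univ c), Finset.card_univ,
    ← Set.ncard_eq_toFinset_card'] at h
  omega

end SimpleGraph

theorem IsMatchingSet.two_mul_ncard_le {V : Type*} [Fintype V] {G : SimpleGraph V}
    {s : Set (Sym2 V)} (hs : IsMatchingSet G s) : 2 * s.ncard ≤ Fintype.card V := by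
  have hdisj : (s.toFinset : Set (Sym2 V)).PairwiseDisjoint Sym2.toFinset := by
    intro e he f hf hef
    refine Finset.disjoint_left.mpr fun v hve hvf => ?_
    exact hs.2 (Set.mem_toFinset.mp he) (Set.mem_toFinset.mp hf) hef v
      (Sym2.mem_toFinset.mp hve) (Sym2.mem_toFinset.mp hvf)
  have hcard : ∀ e ∈ s.toFinset, e.toFinset.card = 2 := fun e he =>
    Sym2.card_toFinset_of_not_isDiag e
      (G.not_isDiag_of_mem_edgeSet (hs.1 (Set.mem_toFinset.mp he)))
  rw [Set.ncard_eq_toFinset_card', mul_comm, ← smul_eq_mul, ← Finset.sum_const,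
    ← Finset.sum_congr rfl hcard, ← Finset.card_biUnion hdisj]
  exact Finset.card_le_univ _

/-- **Lemma.** A tree with `b ≥ 3` leaves and diameter at most `4t` (`t ≥ 1`) has
matching number at most `bt`. -/
theorem matching_le_of_diam_le_four_mul
    {V : Type*} [Fintype V] (b t : ℕ) (hb : 3 ≤ b) (ht : 1 ≤ t)
    (T : SimpleGraph V) (hT : T.IsTree)
    (hleaf : (leaves T).ncard = b) (hdiam : T.diam ≤ 4 * t) :
    matchingNumber T ≤ b * t := by
  obtain ⟨c, hc⟩ := hT.exists_forall_dist_le (r := 2 * t) (by omega)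
  have hcard := hT.card_le_ncard_leaves_mul_add_one hc
  refine csSup_le' ?_
  rintro n ⟨s, hs, rfl⟩
  have := hs.two_mul_ncard_le
  rw [hleaf, Nat.mul_left_comm] at hcard
  omega

end
end

section
/- Let b ≥ 2 and t ≥ 1 be integers. If T is a tree with b leaves, diameter exactly 4t+1, and matching number bt+1, then T is isomorphic to a crab graph CG_{b1, b−b1; 2t} for some integer b1 with 1 ≤ b1 ≤ b−1. -/
open scoped Classical

noncomputable section

theorem SimpleGraph.Connected.exists_dist_eq_and_dist_eq_add {V : Type*} {G : SimpleGraph V}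
    (hG : G.Connected) {r w : V} {k : ℕ} (hk : k ≤ G.dist r w) :
    ∃ z, G.dist r z = k ∧ G.dist r w = k + G.dist z w := by
  obtain ⟨p, hp⟩ := hG.exists_walk_length_eq_dist r w
  have h₁ := SimpleGraph.dist_le (p.take k)
  have h₂ := SimpleGraph.dist_le (p.drop k)
  have h₃ := hG.dist_triangle (u := r) (v := p.getVert k) (w := w)
  rw [SimpleGraph.Walk.take_length] at h₁
  rw [SimpleGraph.Walk.drop_length] at h₂
  exact ⟨p.getVert k, by omega, by omega⟩

theorem SimpleGraph.Connected.exists_adj_dist_add_one_eq {V : Type*} {G : SimpleGraph V}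
    (hG : G.Connected) {r w : V} (h : G.dist r w ≠ 0) :
    ∃ z, G.Adj w z ∧ G.dist r z + 1 = G.dist r w := by
  obtain ⟨z, hz, hzw⟩ := hG.exists_dist_eq_and_dist_eq_add (k := G.dist r w - 1) (Nat.sub_le _ _)
  exact ⟨z, (SimpleGraph.dist_eq_one_iff_adj.mp (by omega)).symm, by omega⟩

theorem SimpleGraph.IsTree.eq_of_adj_of_dist_lt {V : Type*} {G : SimpleGraph V} (hG : G.IsTree)
    {r w z z' : V} (hz : G.Adj w z) (hz' : G.Adj w z') (h : G.dist r z < G.dist r w)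
    (h' : G.dist r z' < G.dist r w) : z = z' := by
  have key : ∀ {y}, G.Adj w y → G.dist r y < G.dist r w →
      ∃ p : G.Walk r w, p.IsPath ∧ p.penultimate = y := fun {y} hy hlt ↦ by
    obtain ⟨p, hp⟩ := hG.connected.exists_walk_length_eq_dist r y
    refine ⟨p.concat hy.symm, SimpleGraph.Walk.isPath_of_length_eq_dist _ ?_, by simp⟩
    have := hG.dist_eq_dist_add_one_of_adj r hy
    rw [SimpleGraph.Walk.length_concat]
    omega
  obtain ⟨p, hp, rfl⟩ := key hz h
  obtain ⟨q, hq, rfl⟩ := key hz' h'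
  rw [(hG.existsUnique_path r w).unique hp hq]

/-- A rooting of a graph at both ends of an edge, all depths being at most `h`. -/
structure EdgeRooting {V : Type*} (T : SimpleGraph V) (h : ℕ) where
  u : V
  v : V
  depth : V → ℕ
  parent : V → V
  adj_centers : T.Adj u v
  depth_eq_zero_iff : ∀ w, depth w = 0 ↔ w = u ∨ w = v
  adj_parent : ∀ w, depth w ≠ 0 → T.Adj w (parent w)
  depth_parent : ∀ w, depth w ≠ 0 → depth (parent w) + 1 = depth w
  adj_cases : ∀ a b, T.Adj a b → (depth b = depth a + 1 ∧ parent b = a) ∨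
    (depth a = depth b + 1 ∧ parent a = b) ∨ (depth a = 0 ∧ depth b = 0)
  depth_le : ∀ w, depth w ≤ h
  exists_child_left : ∃ x, depth x ≠ 0 ∧ parent x = u
  exists_child_right : ∃ y, depth y ≠ 0 ∧ parent y = v

/-- Two adjacent vertices of a tree which are nearest to different ends of an edge are the ends of
that edge. -/
theorem SimpleGraph.IsTree.dist_eq_zero_of_adj_of_sides {V : Type*} {T : SimpleGraph V}
    (hT : T.IsTree) {u v a b : V} (huv : T.Adj u v) (hab : T.Adj a b)
    (ha : T.dist u a < T.dist v a) (hb : T.dist v b < T.dist u b) :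
    T.dist u a = 0 ∧ T.dist v b = 0 := by
  have h₁ := hT.dist_eq_dist_add_one_of_adj a huv
  have h₂ := hT.dist_eq_dist_add_one_of_adj b huv
  have h₃ := hT.dist_eq_dist_add_one_of_adj u hab
  have h₄ := hT.dist_eq_dist_add_one_of_adj v hab
  simp only [T.dist_comm (u := a), T.dist_comm (u := b)] at h₁ h₂
  have hk : T.dist u a = T.dist v b := by omega
  by_contra hne
  obtain ⟨z, hz, hzd⟩ := hT.connected.exists_adj_dist_add_one_eq (r := v) (w := b) (by omega)
  have h₅ := hT.dist_eq_dist_add_one_of_adj z huv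
  simp only [T.dist_comm (u := z)] at h₅
  have := hT.eq_of_adj_of_dist_lt (r := u) hz hab.symm (by omega) (by omega)
  subst this
  omega

/-- If a vertex is strictly nearer to `u` than to its neighbour `v`, its distance to a vertex on
the other side of the edge `uv` is measured through that edge. -/
theorem SimpleGraph.IsTree.dist_add_dist_lt_dist {V : Type*} {T : SimpleGraph V}
    (hT : T.IsTree) {u v a b : V} (huv : T.Adj u v)
    (ha : T.dist u a < T.dist v a) (hb : T.dist v b < T.dist u b) :
    T.dist u a + T.dist v b < T.dist a b := by
  have key : ∀ {x y} (p : T.Walk x y), T.dist v y < T.dist u y →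
      if T.dist u x < T.dist v x then T.dist u x + T.dist v y + 1 ≤ p.length
      else T.dist v y ≤ T.dist v x + p.length := fun {x y} p hy ↦ by
    induction p with
    | nil => rw [if_neg (by omega)]; simp
    | @cons x z y hxz p ih =>
      specialize ih hy
      have h₁ := hT.dist_eq_dist_add_one_of_adj x huv
      have h₂ := hT.dist_eq_dist_add_one_of_adj z huv
      have h₃ := hT.dist_eq_dist_add_one_of_adj u hxz
      have h₄ := hT.dist_eq_dist_add_one_of_adj v hxz
      have h₅ := hT.dist_eq_zero_of_adj_of_sides huv hxz
      simp only [T.dist_comm (u := x), T.dist_comm (u := z)] at h₁ h₂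
      rw [SimpleGraph.Walk.length_cons]
      split_ifs at ih ⊢ <;> grind
  obtain ⟨p, hp⟩ := hT.connected.exists_walk_length_eq_dist a b
  have := key p hb
  rw [if_pos ha] at this
  omega

theorem SimpleGraph.IsTree.nonempty_edgeRooting {V : Type*} [Finite V] {T : SimpleGraph V}
    (hT : T.IsTree) {h : ℕ} (hh : h ≠ 0) (hdiam : T.diam = 2 * h + 1) :
    Nonempty (EdgeRooting T h) := by
  have hc := hT.connected
  have := hc.nonempty
  have hle : ∀ a b, T.dist a b ≤ 2 * h + 1 := fun a b ↦ hdiam ▸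
    SimpleGraph.dist_le_diam (SimpleGraph.ediam_ne_top_of_diam_ne_zero (by omega))
  obtain ⟨x, y, hxy⟩ := T.exists_dist_eq_diam
  rw [hdiam] at hxy
  obtain ⟨u, hu, huy⟩ := hc.exists_dist_eq_and_dist_eq_add (r := x) (w := y) (k := h) (by omega)
  obtain ⟨v, hv, hvy⟩ := hc.exists_dist_eq_and_dist_eq_add (r := u) (w := y) (k := 1) (by omega)
  have huv := SimpleGraph.dist_eq_one_iff_adj.mp hv
  have hxv : T.dist v x = h + 1 := by
    have := hc.dist_triangle (u := x) (v := v) (w := y)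
    have := hT.dist_eq_dist_add_one_of_adj x huv
    rw [T.dist_comm]
    omega
  rw [T.dist_comm] at hu
  have side : ∀ w, T.dist u w = T.dist v w + 1 ∨ T.dist v w = T.dist u w + 1 := fun w ↦ by
    have := hT.dist_eq_dist_add_one_of_adj w huv
    rwa [T.dist_comm (u := w), T.dist_comm (u := w)] at this
  let d : V → ℕ := fun w ↦ min (T.dist u w) (T.dist v w)
  have hside : ∀ {a b}, T.Adj a b → d a ≠ 0 →
      (T.dist u a < T.dist v a ↔ T.dist u b < T.dist v b) := by
    intro a b hab ha
    have h₁ := side a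
    have h₂ := side b
    have h₃ := hT.dist_eq_zero_of_adj_of_sides huv hab
    have h₄ := hT.dist_eq_zero_of_adj_of_sides huv hab.symm
    simp only [d] at ha
    omega
  have hex : ∀ w, ∃ z, d w ≠ 0 → T.Adj w z ∧ d z + 1 = d w := fun w ↦ by
    by_cases hw : d w = 0
    · exact ⟨w, fun h ↦ absurd hw h⟩
    have hside := fun z hz ↦ hside (a := w) (b := z) hz hw
    simp only [d] at hw ⊢
    rcases side w with hs | hs
    · obtain ⟨z, hz, hzd⟩ := hc.exists_adj_dist_add_one_eq (r := v) (w := w) (by omega)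
      have := hside z hz
      exact ⟨z, fun _ ↦ ⟨hz, by omega⟩⟩
    · obtain ⟨z, hz, hzd⟩ := hc.exists_adj_dist_add_one_eq (r := u) (w := w) (by omega)
      have := hside z hz
      exact ⟨z, fun _ ↦ ⟨hz, by omega⟩⟩
  have huniq : ∀ {w z z'}, T.Adj w z → T.Adj w z' → d z < d w → d z' < d w → z = z' := by
    intro w z z' hz hz' hd hd'
    have h₁ := hside hz (by omega)
    have h₂ := hside hz' (by omega)
    simp only [d] at hd hd'
    rcases side w with hs | hs
    · exact hT.eq_of_adj_of_dist_lt (r := v) hz hz' (by omega) (by omega)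
    · exact hT.eq_of_adj_of_dist_lt (r := u) hz hz' (by omega) (by omega)
  choose p hp using hex
  have hpar : ∀ a b, T.Adj a b → d b = d a + 1 → p b = a := fun a b hab hd ↦
    huniq (hp b (by omega)).1 hab.symm (by have := (hp b (by omega)).2; omega) (by omega)
  have hchild : ∀ c x, T.Adj c x → d c = 0 → d x = 1 → d x ≠ 0 ∧ p x = c := fun c x hcx h₀ h₁ ↦
    ⟨by omega, hpar c x hcx (by omega)⟩
  refine ⟨⟨u, v, d, p, huv, fun w ↦ ?_, fun w hw ↦ (hp w hw).1, fun w hw ↦ (hp w hw).2,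
    fun a b hab ↦ ?_, fun w ↦ ?_, ?_, ?_⟩⟩
  · rw [Nat.min_eq_zero_iff, hc.dist_eq_zero_iff, hc.dist_eq_zero_iff, eq_comm, @eq_comm _ v]
  · have hd : d b = d a + 1 ∨ d a = d b + 1 ∨ (d a = 0 ∧ d b = 0) := by
      have h₁ := hT.dist_eq_dist_add_one_of_adj u hab
      have h₂ := hT.dist_eq_dist_add_one_of_adj v hab
      have h₃ := side a
      have h₄ := side b
      have h₅ := hside hab
      have h₆ := hside hab.symm
      simp only [d] at h₅ h₆ ⊢
      omega
    rcases hd with hd | hd | hd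
    · exact .inl ⟨hd, hpar a b hab hd⟩
    · exact .inr (.inl ⟨hd, hpar b a hab.symm hd⟩)
    · exact .inr (.inr hd)
  · rcases side w with hs | hs
    · have := hT.dist_add_dist_lt_dist huv (a := x) (b := w) (by omega) (by omega)
      have := hle x w
      simp only [d]
      omega
    · have := hT.dist_add_dist_lt_dist huv (a := w) (b := y) (by omega) (by omega)
      have := hle w y
      simp only [d]
      omega
  · obtain ⟨z, hz, hzx⟩ := hc.exists_dist_eq_and_dist_eq_add (r := u) (w := x) (k := 1) (by omega)
    refine ⟨z, hchild u z (SimpleGraph.dist_eq_one_iff_adj.mp hz) (by simp [d]) ?_⟩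
    have := hc.dist_triangle (u := v) (v := z) (w := x)
    have := side z
    simp only [d]
    omega
  · obtain ⟨z, hz, hzy⟩ := hc.exists_dist_eq_and_dist_eq_add (r := v) (w := y) (k := 1) (by omega)
    refine ⟨z, hchild v z (SimpleGraph.dist_eq_one_iff_adj.mp hz) (by simp [d]) ?_⟩
    have := hc.dist_triangle (u := u) (v := z) (w := y)
    have := side z
    simp only [d]
    omega

namespace EdgeRooting

variable {V : Type*} {T : SimpleGraph V} {h : ℕ} (R : EdgeRooting T h)

/-- The ancestor of a vertex at a given depth. -/
def ancestor (k : ℕ) (w : V) : V := R.parent^[R.depth w - k] w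

theorem ancestor_depth (w : V) : R.ancestor (R.depth w) w = w := by simp [ancestor]

theorem depth_iterate_parent {w : V} {n : ℕ} (hn : n ≤ R.depth w) :
    R.depth (R.parent^[n] w) = R.depth w - n := by
  induction n with
  | zero => simp
  | succ n ih =>
    rw [Function.iterate_succ_apply']
    have := ih (by omega)
    have := R.depth_parent (R.parent^[n] w) (by omega)
    omega

theorem depth_ancestor {w : V} {k : ℕ} (hk : k ≤ R.depth w) : R.depth (R.ancestor k w) = k := by
  rw [ancestor, R.depth_iterate_parent (Nat.sub_le _ _)]
  omega

theorem ancestor_ancestor {w : V} {j k : ℕ} (hj : j ≤ k) (hk : k ≤ R.depth w) :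
    R.ancestor j (R.ancestor k w) = R.ancestor j w := by
  rw [ancestor, R.depth_ancestor hk, ancestor, ancestor, ← Function.iterate_add_apply]
  congr 1
  omega

theorem parent_ancestor {w : V} {k : ℕ} (hk : k + 1 ≤ R.depth w) :
    R.parent (R.ancestor (k + 1) w) = R.ancestor k w := by
  rw [ancestor, ancestor, ← Function.iterate_succ_apply' R.parent]
  congr 1
  omega

theorem ancestor_parent {w : V} {k : ℕ} (hk : k + 1 ≤ R.depth w) :
    R.ancestor k (R.parent w) = R.ancestor k w := by
  have := R.depth_parent w (by omega)
  rw [ancestor, ancestor, ← Function.iterate_succ_apply R.parent]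
  congr 1
  omega

theorem ancestor_zero_eq (w : V) : R.ancestor 0 w = R.u ∨ R.ancestor 0 w = R.v :=
  (R.depth_eq_zero_iff _).mp (R.depth_ancestor (Nat.zero_le _))

theorem depth_u : R.depth R.u = 0 := (R.depth_eq_zero_iff _).mpr (.inl rfl)

theorem depth_v : R.depth R.v = 0 := (R.depth_eq_zero_iff _).mpr (.inr rfl)

theorem eq_of_mem_leaves {l a b : V} (hl : l ∈ leaves T) (ha : T.Adj l a) (hb : T.Adj l b) :
    a = b := by
  obtain ⟨c, hc⟩ := Set.ncard_eq_one.mp (show (T.neighborSet l).ncard = 1 from hl)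
  have ha : a ∈ T.neighborSet l := ha
  have hb : b ∈ T.neighborSet l := hb
  rw [hc] at ha hb
  exact ha.trans hb.symm

theorem depth_ne_zero_of_mem_leaves {l : V} (hl : l ∈ leaves T) : R.depth l ≠ 0 := by
  intro h₀
  have key : ∀ a b, T.Adj a b → R.depth b = 0 → (∃ x, R.depth x ≠ 0 ∧ R.parent x = a) →
      l ≠ a := by
    rintro _ b hab hb ⟨x, hx, rfl⟩ rfl
    exact hx (eq_of_mem_leaves hl hab (R.adj_parent x hx).symm ▸ hb)
  rcases (R.depth_eq_zero_iff l).mp h₀ with h₁ | h₁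
  · exact key _ _ R.adj_centers R.depth_v R.exists_child_left h₁
  · exact key _ _ R.adj_centers.symm R.depth_u R.exists_child_right h₁

theorem exists_mem_leaves_ancestor_eq (w : V) (hw : R.depth w ≠ 0) :
    ∃ l ∈ leaves T, R.depth w ≤ R.depth l ∧ R.ancestor (R.depth w) l = w := by
  by_cases hc : ∃ c, R.depth c ≠ 0 ∧ R.parent c = w
  · obtain ⟨c, hc₀, rfl⟩ := hc
    have hd := R.depth_parent c hc₀
    have := R.depth_le c
    obtain ⟨l, hl, hle, heq⟩ := exists_mem_leaves_ancestor_eq c hc₀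
    refine ⟨l, hl, by omega, ?_⟩
    rw [← R.parent_ancestor (by omega), hd, heq]
  · refine ⟨w, ?_, le_rfl, R.ancestor_depth w⟩
    refine Set.ncard_eq_one.mpr ⟨R.parent w, Set.eq_singleton_iff_unique_mem.mpr
      ⟨R.adj_parent w hw, fun x hx ↦ ?_⟩⟩
    rcases R.adj_cases w x hx with h₁ | h₁ | h₁
    · exact absurd ⟨x, by omega, h₁.2⟩ hc
    · exact h₁.2.symm
    · exact absurd h₁.1 hw
termination_by h - R.depth w

theorem exists_leafBelow : ∃ g : V → V, ∀ w, R.depth w ≠ 0 →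
    g w ∈ leaves T ∧ R.depth w ≤ R.depth (g w) ∧ R.ancestor (R.depth w) (g w) = w := by
  have hex : ∀ w, ∃ l, R.depth w ≠ 0 →
      l ∈ leaves T ∧ R.depth w ≤ R.depth l ∧ R.ancestor (R.depth w) l = w := fun w ↦ by
    by_cases hw : R.depth w = 0
    · exact ⟨w, fun h ↦ absurd hw h⟩
    · obtain ⟨l, hl⟩ := R.exists_mem_leaves_ancestor_eq w hw
      exact ⟨l, fun _ ↦ hl⟩
  choose g hg using hex
  exact ⟨g, hg⟩

theorem eq_or_eq_of_adj_of_depth_eq_zero {a b c : V}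
    (hab : T.Adj a b) (ha : R.depth a = 0) (hb : R.depth b = 0) (hc : R.depth c = 0) :
    a = c ∨ b = c := by
  have := hab.ne
  rw [R.depth_eq_zero_iff] at ha hb hc
  grind

/-- To check that a set as in `matchingNumber_le_of_cover` is a vertex cover, it suffices to
look at the edges incident to the centers. -/
theorem cover_of_parity (r : V) (hr : R.depth r = 0) (parity : V → ℕ)
    (hparity : ∀ w, parity w < 2)
    (hroot : ∀ w, R.depth w = 1 → parity w = 1 ∨ R.parent w = r) (a b : V) (hab : T.Adj a b) :
      (a = r ∨ R.depth a ≠ 0 ∧ R.depth a % 2 = parity (R.ancestor 1 a)) ∨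
      (b = r ∨ R.depth b ≠ 0 ∧ R.depth b % 2 = parity (R.ancestor 1 b)) := by
  have key : ∀ {a b}, R.depth b = R.depth a + 1 → R.parent b = a →
      (a = r ∨ R.depth a ≠ 0 ∧ R.depth a % 2 = parity (R.ancestor 1 a)) ∨
      (b = r ∨ R.depth b ≠ 0 ∧ R.depth b % 2 = parity (R.ancestor 1 b)) := by
    rintro _ b hd rfl
    by_cases h₀ : R.depth (R.parent b) = 0
    · have hb : R.depth b = 1 := by omega
      rcases hroot b hb with hp | hp
      · have := R.ancestor_depth b
        rw [hb] at this
        exact .inr (.inr ⟨by omega, by rw [this, hb, hp]⟩)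
      · exact .inl (.inl hp)
    · have := hparity (R.ancestor 1 b)
      rw [R.ancestor_parent (by omega)]
      omega
  rcases R.adj_cases a b hab with ⟨hd, hp⟩ | ⟨hd, hp⟩ | ⟨ha, hb⟩
  · exact key hd hp
  · exact (key hd hp).symm
  · exact (R.eq_or_eq_of_adj_of_depth_eq_zero hab ha hb hr).imp .inl .inl

end EdgeRooting

theorem matchingNumber_le_card {V : Type*} [Fintype V] {T : SimpleGraph V} (S : Finset V)
    (hS : ∀ a b, T.Adj a b → a ∈ S ∨ b ∈ S) : matchingNumber T ≤ S.card := by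
  refine csSup_le ⟨0, ∅, ⟨Set.empty_subset _, Set.pairwise_empty _⟩, Set.ncard_empty _⟩ ?_
  rintro n ⟨s, ⟨hsub, hdisj⟩, rfl⟩
  have hex : ∀ e : Sym2 V, ∃ c, e ∈ s → c ∈ e ∧ c ∈ S := fun e ↦ by
    induction e with
    | h a b =>
      by_cases he : s(a, b) ∈ s
      · rcases hS a b (hsub he) with ha | hb
        · exact ⟨a, fun _ ↦ ⟨Sym2.mem_mk_left a b, ha⟩⟩
        · exact ⟨b, fun _ ↦ ⟨Sym2.mem_mk_right a b, hb⟩⟩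
      · exact ⟨a, fun h ↦ absurd h he⟩
  choose c hc using hex
  rw [← Set.ncard_coe_finset S]
  refine Set.ncard_le_ncard_of_injOn c (fun e he ↦ (hc e he).2) (fun e he f hf hef ↦ ?_)
    S.finite_toSet
  by_contra hne
  exact hdisj he hf hne _ (hc e he).1 (hef ▸ (hc f hf).1)

namespace EdgeRooting

variable {V : Type*} [Fintype V] {T : SimpleGraph V} {t : ℕ} (R : EdgeRooting T (2 * t))

/-- A vertex cover consisting of a vertex `r` and vertices of positive depth whose parity is
constant on each branch bounds the matching number by `t` times the number of leaves, provided
that some pair `(l, k)` is not of the form `(g w, (depth w - 1) / 2)` with `w` in the cover. -/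
theorem matchingNumber_le_of_cover (g : V → V) (hg : ∀ w, R.depth w ≠ 0 →
      g w ∈ leaves T ∧ R.depth w ≤ R.depth (g w) ∧ R.ancestor (R.depth w) (g w) = w)
    (r : V) (parity : V → ℕ) (l : V) (hl : l ∈ leaves T) (k : ℕ) (hk : k < t)
    (hcover : ∀ a b, T.Adj a b →
      (a = r ∨ R.depth a ≠ 0 ∧ R.depth a % 2 = parity (R.ancestor 1 a)) ∨
      (b = r ∨ R.depth b ≠ 0 ∧ R.depth b % 2 = parity (R.ancestor 1 b)))
    (hmiss : ∀ w, R.depth w ≠ 0 → R.depth w % 2 = parity (R.ancestor 1 w) → g w = l →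
      (R.depth w - 1) / 2 ≠ k) :
    matchingNumber T ≤ (leaves T).ncard * t := by
  set S : Finset V :=
    {w | R.depth w ≠ 0 ∧ R.depth w % 2 = parity (R.ancestor 1 w)} with hS
  have hmem : ∀ w, w ∈ S ↔ R.depth w ≠ 0 ∧ R.depth w % 2 = parity (R.ancestor 1 w) := by
    simp [hS]
  have hcard : S.card ≤ (((leaves T).toFinset ×ˢ Finset.range t).erase (l, k)).card := by
    refine Finset.card_le_card_of_injOn (fun w ↦ (g w, (R.depth w - 1) / 2)) ?_ ?_
    · intro w hw
      obtain ⟨hw₀, hw₁⟩ := (hmem w).mp hw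
      have := R.depth_le w
      rw [Finset.mem_coe, Finset.mem_erase, Finset.mem_product, Set.mem_toFinset, Finset.mem_range]
      exact ⟨fun he ↦ hmiss w hw₀ hw₁ (congrArg Prod.fst he) (congrArg Prod.snd he),
        (hg w hw₀).1, by dsimp only; omega⟩
    · intro w hw w' hw' he
      obtain ⟨hw₀, hw₁⟩ := (hmem w).mp hw
      obtain ⟨hw₀', hw₁'⟩ := (hmem w').mp hw'
      obtain ⟨-, hle, heq⟩ := hg w hw₀
      obtain ⟨-, hle', heq'⟩ := hg w' hw₀'
      obtain ⟨he₁, he₂⟩ := Prod.mk.inj he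
      have h₁ : R.ancestor 1 w = R.ancestor 1 w' := by
        rw [← heq, ← heq', R.ancestor_ancestor (by omega) hle,
          R.ancestor_ancestor (by omega) hle', he₁]
      rw [h₁, ← hw₁'] at hw₁
      have hd : R.depth w = R.depth w' := by omega
      rw [← heq, ← heq', he₁, hd]
  have hpos : (l, k) ∈ (leaves T).toFinset ×ˢ Finset.range t := by simp [hl, hk]
  have := Finset.card_pos.mpr ⟨_, hpos⟩
  rw [Finset.card_erase_of_mem hpos, Finset.card_product, Finset.card_range,
    ← Set.ncard_eq_toFinset_card'] at hcard
  rw [Finset.card_product, Finset.card_range, ← Set.ncard_eq_toFinset_card'] at this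
  have hcov := matchingNumber_le_card (T := T) (insert r S) fun a b hab ↦ by
    simpa only [Finset.mem_insert, hmem] using hcover a b hab
  have := Finset.card_insert_le r S
  omega

variable {R}

theorem depth_eq_of_mem_leaves
    (hmatch : (leaves T).ncard * t < matchingNumber T) {l : V} (hl : l ∈ leaves T) :
    R.depth l = 2 * t := by
  by_contra hne
  have hlt := lt_of_le_of_ne (R.depth_le l) hne
  have hl₀ := R.depth_ne_zero_of_mem_leaves hl
  obtain ⟨g, hg⟩ := R.exists_leafBelow
  refine hmatch.not_ge (R.matchingNumber_le_of_cover g hg (R.ancestor 0 l)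
    (fun w ↦ if w = R.ancestor 1 l then 0 else 1) l hl (t - 1) (by omega)
    (R.cover_of_parity _ (R.depth_ancestor (Nat.zero_le _))
      (fun w ↦ if w = R.ancestor 1 l then 0 else 1) ?_ ?_) ?_)
  · intro w
    split_ifs <;> omega
  · intro w _
    split_ifs with hw
    · exact .inr (hw ▸ R.parent_ancestor (by omega))
    · exact .inl rfl
  · rintro w hw₀ hw rfl
    obtain ⟨-, hle, heq⟩ := hg w hw₀
    have : R.ancestor 1 w = R.ancestor 1 (g w) := by
      rw [← R.ancestor_ancestor (k := R.depth w) (by omega) hle, heq]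
    rw [if_pos this] at hw
    omega

theorem eq_of_ancestor_one_eq (ht : t ≠ 0)
    (hmatch : (leaves T).ncard * t < matchingNumber T) {l l' : V} (hl : l ∈ leaves T)
    (hl' : l' ∈ leaves T) (heq : R.ancestor 1 l = R.ancestor 1 l') : l = l' := by
  by_contra hne
  obtain ⟨g, hg⟩ := R.exists_leafBelow
  obtain ⟨m, hm, hmeq, hmg⟩ : ∃ m ∈ leaves T, R.ancestor 1 m = R.ancestor 1 l ∧
      g (R.ancestor 1 m) ≠ m := by
    by_cases h₁ : g (R.ancestor 1 l) = l
    · exact ⟨l', hl', heq.symm, by rwa [← heq, h₁]⟩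
    · exact ⟨l, hl, rfl, h₁⟩
  refine hmatch.not_ge (R.matchingNumber_le_of_cover g hg R.u (fun _ ↦ 1) m hm 0 (by omega)
    (R.cover_of_parity _ R.depth_u (fun _ ↦ 1) (by simp) (by simp)) ?_)
  rintro w hw₀ hw rfl hk
  have hw₁ : R.depth w = 1 := by omega
  have := (hg w hw₀).2.2
  rw [hw₁] at this
  exact hmg (congrArg g this)

end EdgeRooting

/-- If all leaves have depth `r` and lie on different branches, a rooting at an edge exhibits the
graph as a crab. -/
theorem EdgeRooting.nonempty_iso_crab {V : Type*} {T : SimpleGraph V} {r b₁ b₂ : ℕ}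
    (R : EdgeRooting T r) (hdepth : ∀ l ∈ leaves T, R.depth l = r)
    (hinj : ∀ l ∈ leaves T, ∀ l' ∈ leaves T, R.ancestor 1 l = R.ancestor 1 l' → l = l')
    (e₁ : Fin b₁ ≃ {l // l ∈ leaves T ∧ R.ancestor 0 l = R.u})
    (e₂ : Fin b₂ ≃ {l // l ∈ leaves T ∧ R.ancestor 0 l = R.v}) :
    Nonempty (T ≃g crab b₁ b₂ r) := by
  let F : CrabV b₁ b₂ r → V
    | .inl none => R.u
    | .inr none => R.v
    | .inl (some (i, j)) => R.ancestor (j.val + 1) (e₁ i).val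
    | .inr (some (i, j)) => R.ancestor (j.val + 1) (e₂ i).val
  have hd : ∀ {l}, l ∈ leaves T → ∀ j : Fin r, j.val + 1 ≤ R.depth l := fun hl j ↦ by
    rw [hdepth _ hl]
    exact j.isLt
  have hleg : ∀ {l l'}, l ∈ leaves T → l' ∈ leaves T → ∀ {j j' : Fin r},
      R.ancestor (j.val + 1) l = R.ancestor (j'.val + 1) l' → l = l' ∧ j = j' := by
    intro l l' hl hl' j j' he
    have hj := congrArg R.depth he
    rw [R.depth_ancestor (hd hl j), R.depth_ancestor (hd hl' j')] at hj
    have hj : j = j' := Fin.ext (by omega)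
    subst hj
    refine ⟨hinj l hl l' hl' ?_, rfl⟩
    rw [← R.ancestor_ancestor (by omega) (hd hl j), he, R.ancestor_ancestor (by omega) (hd hl' j)]
  have hcenter : ∀ {l c}, l ∈ leaves T → R.depth c = 0 → ∀ j : Fin r,
      R.ancestor (j.val + 1) l ≠ c := by
    rintro l _ hl hc j rfl
    rw [R.depth_ancestor (hd hl j)] at hc
    omega
  have huv := R.adj_centers.ne
  have hFinj : Function.Injective F := by
    rintro ((_ | ⟨i, j⟩) | (_ | ⟨i, j⟩)) ((_ | ⟨i', j'⟩) | (_ | ⟨i', j'⟩)) he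
    · rfl
    · exact absurd he.symm (hcenter (e₁ i').2.1 R.depth_u j')
    · exact absurd he huv
    · exact absurd he.symm (hcenter (e₂ i').2.1 R.depth_u j')
    · exact absurd he (hcenter (e₁ i).2.1 R.depth_u j)
    · obtain ⟨hl, rfl⟩ := hleg (e₁ i).2.1 (e₁ i').2.1 he
      rw [e₁.injective (Subtype.ext hl)]
    · exact absurd he (hcenter (e₁ i).2.1 R.depth_v j)
    · have hl := (hleg (e₁ i).2.1 (e₂ i').2.1 he).1
      exact absurd ((e₁ i).2.2.symm.trans (hl ▸ (e₂ i').2.2)) huv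
    · exact absurd he huv.symm
    · exact absurd he.symm (hcenter (e₁ i').2.1 R.depth_v j')
    · rfl
    · exact absurd he.symm (hcenter (e₂ i').2.1 R.depth_v j')
    · exact absurd he (hcenter (e₂ i).2.1 R.depth_u j)
    · have hl := (hleg (e₂ i).2.1 (e₁ i').2.1 he).1
      exact absurd ((e₁ i').2.2.symm.trans (hl ▸ (e₂ i).2.2)) huv
    · exact absurd he (hcenter (e₂ i).2.1 R.depth_v j)
    · obtain ⟨hl, rfl⟩ := hleg (e₂ i).2.1 (e₂ i').2.1 he
      rw [e₂.injective (Subtype.ext hl)]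
  have hFsurj : Function.Surjective F := by
    intro w
    by_cases hw : R.depth w = 0
    · rcases (R.depth_eq_zero_iff w).mp hw with rfl | rfl
      · exact ⟨.inl none, rfl⟩
      · exact ⟨.inr none, rfl⟩
    · obtain ⟨l, hl, -, heq⟩ := R.exists_mem_leaves_ancestor_eq w hw
      have hwr := R.depth_le w
      have hw₁ : R.depth w - 1 + 1 = R.depth w := by omega
      rcases R.ancestor_zero_eq l with h₀ | h₀
      · refine ⟨.inl (some (e₁.symm ⟨l, hl, h₀⟩, ⟨R.depth w - 1, by omega⟩)), ?_⟩
        simp only [F, Equiv.apply_symm_apply, hw₁, heq]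
      · refine ⟨.inr (some (e₂.symm ⟨l, hl, h₀⟩, ⟨R.depth w - 1, by omega⟩)), ?_⟩
        simp only [F, Equiv.apply_symm_apply, hw₁, heq]
  have hadj : ∀ {l}, l ∈ leaves T → ∀ {k}, k + 1 ≤ r →
      T.Adj (R.ancestor k l) (R.ancestor (k + 1) l) := by
    intro l hl k hk
    rw [← hdepth l hl] at hk
    rw [← R.parent_ancestor hk]
    exact (R.adj_parent _ (by rw [R.depth_ancestor hk]; omega)).symm
  have hrel : ∀ x y, crabRel b₁ b₂ r x y → T.Adj (F x) (F y) := by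
    rintro ((_ | ⟨i, j⟩) | (_ | ⟨i, j⟩)) ((_ | ⟨i', j'⟩) | (_ | ⟨i', j'⟩)) hxy <;>
      simp only [crabRel] at hxy
    · have := hadj (e₁ i').2.1 (k := 0) (by omega)
      simpa only [F, hxy, (e₁ i').2.2] using this
    · exact R.adj_centers
    · obtain ⟨rfl, hj⟩ := hxy
      simpa only [F, hj] using hadj (e₁ i).2.1 (k := j + 1) (by omega)
    · have := hadj (e₂ i').2.1 (k := 0) (by omega)
      simpa only [F, hxy, (e₂ i').2.2] using this
    · obtain ⟨rfl, hj⟩ := hxy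
      simpa only [F, hj] using hadj (e₂ i).2.1 (k := j + 1) (by omega)
  have hpar : ∀ y, R.depth (F y) ≠ 0 → ∃ x, crabRel b₁ b₂ r x y ∧ F x = R.parent (F y) := by
    rintro ((_ | ⟨i, ⟨_ | j, hj⟩⟩) | (_ | ⟨i, ⟨_ | j, hj⟩⟩)) hy
    · exact absurd R.depth_u hy
    · exact ⟨.inl none, rfl,
        (e₁ i).2.2.symm.trans (R.parent_ancestor (hd (e₁ i).2.1 ⟨0, hj⟩)).symm⟩
    · exact ⟨.inl (some (i, ⟨j, by omega⟩)), ⟨rfl, rfl⟩,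
        (R.parent_ancestor (hd (e₁ i).2.1 ⟨j + 1, hj⟩)).symm⟩
    · exact absurd R.depth_v hy
    · exact ⟨.inr none, rfl,
        (e₂ i).2.2.symm.trans (R.parent_ancestor (hd (e₂ i).2.1 ⟨0, hj⟩)).symm⟩
    · exact ⟨.inr (some (i, ⟨j, by omega⟩)), ⟨rfl, rfl⟩,
        (R.parent_ancestor (hd (e₂ i).2.1 ⟨j + 1, hj⟩)).symm⟩
  have hrel' : ∀ x y, R.depth (F y) = R.depth (F x) + 1 → R.parent (F y) = F x →
      crabRel b₁ b₂ r x y := fun x y hxy hp ↦ by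
    obtain ⟨x', hx', he⟩ := hpar y (by omega)
    rwa [← hFinj (he.trans hp)]
  refine ⟨(⟨Equiv.ofBijective F ⟨hFinj, hFsurj⟩, fun {x y} ↦ ?_⟩ : crab b₁ b₂ r ≃g T).symm⟩
  rw [crab, SimpleGraph.fromRel_adj]
  constructor
  · intro hxy
    refine ⟨fun he ↦ hxy.ne (congrArg F he), ?_⟩
    rcases R.adj_cases _ _ hxy with ⟨h₁, h₂⟩ | ⟨h₁, h₂⟩ | ⟨h₁, h₂⟩
    · exact .inl (hrel' x y h₁ h₂)
    · exact .inr (hrel' y x h₁ h₂)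
    · rcases (R.depth_eq_zero_iff (F x)).mp h₁ with hx | hx <;>
        rcases (R.depth_eq_zero_iff (F y)).mp h₂ with hy | hy
      · exact absurd (hx.trans hy.symm) hxy.ne
      · obtain rfl := @hFinj x (.inl none) hx
        obtain rfl := @hFinj y (.inr none) hy
        exact .inl trivial
      · obtain rfl := @hFinj x (.inr none) hx
        obtain rfl := @hFinj y (.inl none) hy
        exact .inr trivial
      · exact absurd (hx.trans hy.symm) hxy.ne
  · rintro ⟨-, hxy | hxy⟩
    · exact hrel x y hxy
    · exact (hrel y x hxy).symm

/-- Each center of a rooting at an edge lies above some leaf. -/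
theorem EdgeRooting.exists_mem_leaves_ancestor_zero_eq {V : Type*} {T : SimpleGraph V} {h : ℕ}
    (R : EdgeRooting T h) {c x : V} (hc : R.depth c = 0) (hx : R.depth x ≠ 0)
    (hxc : R.parent x = c) : ∃ l ∈ leaves T, R.ancestor 0 l = c := by
  obtain ⟨l, hl, hle, heq⟩ := R.exists_mem_leaves_ancestor_eq x hx
  have hd := R.depth_parent x hx
  rw [hxc, hc] at hd
  rw [← hd, zero_add] at hle heq
  exact ⟨l, hl, by rw [← R.parent_ancestor hle, heq, hxc]⟩

/-- **Lemma.** A tree with `b ≥ 2` leaves, diameter exactly `4t+1` (`t ≥ 1`) and matching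
number `bt+1` is a crab graph `CG_{b₁,b−b₁;2t}` for some `1 ≤ b₁ ≤ b−1`. -/
theorem crab_of_diam_matching
    {V : Type*} [Fintype V] (b t : ℕ) (hb : 2 ≤ b) (ht : 1 ≤ t)
    (T : SimpleGraph V) (hT : T.IsTree)
    (hleaf : (leaves T).ncard = b) (hdiam : T.diam = 4 * t + 1)
    (hmatch : matchingNumber T = b * t + 1) :
    ∃ b₁ : ℕ, 1 ≤ b₁ ∧ b₁ ≤ b - 1 ∧ Nonempty (T ≃g crab b₁ (b - b₁) (2 * t)) := by
  obtain ⟨R⟩ := hT.nonempty_edgeRooting (h := 2 * t) (by omega) (by omega)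
  have hlt : (leaves T).ncard * t < matchingNumber T := by rw [hleaf, hmatch]; omega
  set L₁ : Set V := {l | l ∈ leaves T ∧ R.ancestor 0 l = R.u} with hL₁
  set L₂ : Set V := {l | l ∈ leaves T ∧ R.ancestor 0 l = R.v} with hL₂
  have hunion : L₁ ∪ L₂ = leaves T := by
    ext l
    have := R.ancestor_zero_eq l
    simp only [hL₁, hL₂, Set.mem_union, Set.mem_ofPred_eq]
    tauto
  have hdisj : Disjoint L₁ L₂ := Set.disjoint_left.mpr fun l h₁ h₂ ↦
    R.adj_centers.ne (h₁.2.symm.trans h₂.2)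
  have hcard := Set.ncard_union_eq hdisj
  rw [hunion, hleaf] at hcard
  have hpos₁ : 0 < L₁.ncard := by
    obtain ⟨x, hx, hxu⟩ := R.exists_child_left
    exact (Set.ncard_pos).mpr (R.exists_mem_leaves_ancestor_zero_eq R.depth_u hx hxu)
  have hpos₂ : 0 < L₂.ncard := by
    obtain ⟨x, hx, hxv⟩ := R.exists_child_right
    exact (Set.ncard_pos).mpr (R.exists_mem_leaves_ancestor_zero_eq R.depth_v hx hxv)
  refine ⟨L₁.ncard, hpos₁, by omega, R.nonempty_iso_crab
    (fun l hl ↦ EdgeRooting.depth_eq_of_mem_leaves hlt hl)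
    (fun l hl l' hl' ↦ EdgeRooting.eq_of_ancestor_one_eq (by omega) hlt hl hl')
    (Finite.equivFinOfCardEq (Nat.card_coe_set_eq L₁)).symm
    (Finite.equivFinOfCardEq (?_ : Nat.card L₂ = b - L₁.ncard)).symm⟩
  rw [Nat.card_coe_set_eq]
  omega

end
end

section
/- Let b ≥ 3 and t ≥ 1 be integers. If T is a tree with b leaves and diameter at most 4t+2, then the matching number of T is at most bt+1. -/
open scoped Classical

noncomputable section

namespace SimpleGraph

variable {V : Type*} {T : SimpleGraph V}

theorem IsTree.length_eq_dist_of_isPath (hT : T.IsTree) {u v : V} {p : T.Walk u v}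
    (hp : p.IsPath) : p.length = T.dist u v := by
  obtain ⟨q, hq, hlen⟩ := hT.connected.exists_path_of_dist u v
  rw [← hlen, (hT.existsUnique_path u v).unique hp hq]

theorem IsTree.dist_add_dist_of_mem_support (hT : T.IsTree) {u v w : V} {p : T.Walk u v}
    (hp : p.IsPath) (hw : w ∈ p.support) : T.dist u w + T.dist w v = T.dist u v := by
  rw [← hT.length_eq_dist_of_isPath (hp.takeUntil hw),
    ← hT.length_eq_dist_of_isPath (hp.dropUntil hw), ← hT.length_eq_dist_of_isPath hp,
    ← Walk.length_append, p.take_spec hw]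

theorem IsTree.getVert_dist_of_dist_add_dist (hT : T.IsTree) {u v w : V} {p : T.Walk u v}
    (hp : p.IsPath) (hw : T.dist u w + T.dist w v = T.dist u v) :
    p.getVert (T.dist u w) = w := by
  obtain ⟨q, hq⟩ := hT.connected.exists_walk_length_eq_dist u w
  obtain ⟨r, hr⟩ := hT.connected.exists_walk_length_eq_dist w v
  have hqr : (q.append r).IsPath :=
    Walk.isPath_of_length_eq_dist _ (by rw [Walk.length_append, hq, hr, hw])
  rw [(hT.existsUnique_path u v).unique hp hqr, Walk.getVert_append, hq]
  simp

/-- Removing a vertex between `u` and `v` separates every other vertex from `u` or from `v`. -/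
theorem IsTree.dist_add_dist_or (hT : T.IsTree) {u v c : V}
    (hc : T.dist u c + T.dist c v = T.dist u v) (w : V) :
    T.dist u c + T.dist c w = T.dist u w ∨ T.dist w c + T.dist c v = T.dist w v := by
  obtain ⟨p, hp, -⟩ := hT.connected.exists_path_of_dist u w
  obtain ⟨q, hq, -⟩ := hT.connected.exists_path_of_dist w v
  have hmem : c ∈ (p.append q).support := by
    apply Walk.support_bypass_subset_support
    have := hT.getVert_dist_of_dist_add_dist (p.append q).bypass_isPath hc
    rw [← this]
    exact Walk.getVert_mem_support _ _
  rcases (Walk.mem_support_append_iff _ _).1 hmem with h | h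
  · exact .inl (hT.dist_add_dist_of_mem_support hp h)
  · exact .inr (hT.dist_add_dist_of_mem_support hq h)

/-- In a rooted tree, every vertex has at most one neighbour that is not farther from the root. -/
theorem IsTree.eq_of_adj_of_dist_le (hT : T.IsTree) {c x y z : V} (hy : T.Adj x y)
    (hz : T.Adj x z) (hdy : T.dist c y ≤ T.dist c x) (hdz : T.dist c z ≤ T.dist c x) :
    y = z := by
  obtain ⟨p, hp, -⟩ := hT.connected.exists_path_of_dist c x
  have key (a : V) (ha : T.Adj x a) (hda : T.dist c a ≤ T.dist c x) :
      p.getVert (T.dist c x - 1) = a := by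
    have h1 := hT.dist_eq_dist_add_one_of_adj c ha
    have h2 : T.dist a x = 1 := dist_eq_one_iff_adj.2 ha.symm
    have := hT.getVert_dist_of_dist_add_dist hp (w := a) (by omega)
    rwa [show T.dist c x - 1 = T.dist c a by omega]
  rw [← key y hy hdy, key z hz hdz]

theorem IsTree.exists_mem_leaves_dist_add_dist [Finite V] (hT : T.IsTree) {c w : V}
    (hw : T.dist c w ≠ 0) : ∃ x ∈ leaves T, T.dist c w + T.dist w x = T.dist c x := by
  obtain ⟨x, hx, hmax⟩ := Set.exists_max_image {x | T.dist c w + T.dist w x = T.dist c x}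
    (T.dist c) (Set.toFinite _) ⟨w, by simp⟩
  simp only [Set.mem_ofPred_eq] at hx hmax
  have hdesc (y : V) (hy : T.Adj x y) : T.dist c y ≤ T.dist c x := by
    by_contra! hlt
    have h1 := hT.dist_eq_dist_add_one_of_adj c hy
    have h2 := hT.connected.dist_triangle (u := c) (v := w) (w := y)
    have h3 := hT.dist_eq_dist_add_one_of_adj w hy
    have h4 := hmax y (by omega)
    omega
  have : Nontrivial V := ⟨c, w, fun h => hw (by simp [h])⟩
  obtain ⟨y, hy⟩ := hT.connected.preconnected.exists_adj_of_nontrivial x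
  refine ⟨x, Set.ncard_eq_one.2 ⟨y, Set.ext fun z => ⟨fun hz => ?_, fun hz => ?_⟩⟩, hx⟩
  · exact hT.eq_of_adj_of_dist_le hz hy (hdesc z hz) (hdesc y hy)
  · rw [Set.mem_singleton_iff.1 hz]
    exact hy

theorem IsTree.ncard_dist_eq_le_ncard_leaves [Finite V] (hT : T.IsTree) (c : V) {k : ℕ}
    (hk : k ≠ 0) : {w | T.dist c w = k}.ncard ≤ (leaves T).ncard := by
  have hex (w : V) (hw : T.dist c w = k) := hT.exists_mem_leaves_dist_add_dist (hw ▸ hk)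
  choose f hf hfd using hex
  refine Set.ncard_le_ncard_of_injOn (fun w => if h : T.dist c w = k then f w h else w)
    (fun w hw => ?_) (fun w hw w' hw' h => ?_) (Set.toFinite _)
  · simpa [show T.dist c w = k from hw] using hf w hw
  · have hw : T.dist c w = k := hw
    have hw' : T.dist c w' = k := hw'
    have h : f w hw = f w' hw' := by simpa [hw, hw'] using h
    obtain ⟨p, hp, -⟩ := hT.connected.exists_path_of_dist c (f w hw)
    have h1 := hT.getVert_dist_of_dist_add_dist hp (hfd w hw)
    have h2 := hT.getVert_dist_of_dist_add_dist hp (w := w') (by rw [h]; exact hfd w' hw')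
    rw [← h1, ← h2, hw, hw']

theorem IsTree.ncard_even_dist_le [Finite V] (hT : T.IsTree) {c : V} {t : ℕ}
    (hc : ∀ w, T.dist c w ≤ 2 * t + 1) :
    {w | Even (T.dist c w)}.ncard ≤ (leaves T).ncard * t + 1 := by
  have hsub : {w | Even (T.dist c w)} ⊆
      {c} ∪ ⋃ i ∈ Finset.range t, {w | T.dist c w = 2 * (i + 1)} := by
    intro w hw
    obtain ⟨m, hm⟩ := hw
    have hle := hc w
    simp only [Set.mem_union, Set.mem_singleton_iff, Set.mem_iUnion, Finset.mem_range,
      Set.mem_ofPred_eq, exists_prop]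
    rcases m with _ | m
    · exact .inl (hT.connected.dist_eq_zero_iff.1 hm).symm
    · exact .inr ⟨m, by omega, by omega⟩
  calc {w | Even (T.dist c w)}.ncard
      ≤ ({c} ∪ ⋃ i ∈ Finset.range t, {w | T.dist c w = 2 * (i + 1)}).ncard :=
        Set.ncard_le_ncard hsub (Set.toFinite _)
    _ ≤ ({c} : Set V).ncard + (⋃ i ∈ Finset.range t, {w | T.dist c w = 2 * (i + 1)}).ncard :=
        Set.ncard_union_le _ _
    _ ≤ 1 + ∑ i ∈ Finset.range t, {w | T.dist c w = 2 * (i + 1)}.ncard := by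
        rw [Set.ncard_singleton]
        exact Nat.add_le_add_left (Finset.set_ncard_biUnion_le _ _) _
    _ ≤ 1 + ∑ _i ∈ Finset.range t, (leaves T).ncard := by
        exact Nat.add_le_add_left (Finset.sum_le_sum fun i _ =>
          hT.ncard_dist_eq_le_ncard_leaves c (by omega)) _
    _ = (leaves T).ncard * t + 1 := by
        rw [Finset.sum_const, Finset.card_range, smul_eq_mul]
        ring

end SimpleGraph

/-- A matching has at most as many edges as a vertex cover has vertices. -/
theorem IsMatchingSet.ncard_le_of_forall_exists_mem {V : Type*} [Finite V] {G : SimpleGraph V}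
    {s : Set (Sym2 V)} (hs : IsMatchingSet G s) {C : Set V} (hC : ∀ e ∈ G.edgeSet, ∃ v ∈ C, v ∈ e) :
    s.ncard ≤ C.ncard := by
  have hex (e : s) := hC e (hs.1 e.2)
  choose f hfC hfe using hex
  rw [← Nat.card_coe_set_eq, ← Nat.card_coe_set_eq]
  refine Nat.card_le_card_of_injective (fun e => (⟨f e, hfC e⟩ : C)) fun e e' h => ?_
  by_contra hne
  refine hs.2 e.2 e'.2 (fun h' => hne (Subtype.ext h')) _ (hfe e) ?_
  rw [show f e = f e' from congrArg Subtype.val h]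
  exact hfe e'

/-- **Lemma.** A tree with `b ≥ 3` leaves and diameter at most `4t+2` (`t ≥ 1`) has
matching number at most `bt+1`. -/
theorem matching_le_of_diam_le_four_mul_add_two
    {V : Type*} [Fintype V] (b t : ℕ) (hb : 3 ≤ b) (ht : 1 ≤ t)
    (T : SimpleGraph V) (hT : T.IsTree)
    (hleaf : (leaves T).ncard = b) (hdiam : T.diam ≤ 4 * t + 2) :
    matchingNumber T ≤ b * t + 1 := by
  obtain ⟨c, hc⟩ := hT.exists_forall_dist_le (r := 2 * t + 1) (by omega)
  refine csSup_le ⟨0, ∅, ⟨Set.empty_subset _, Set.pairwise_empty _⟩, Set.ncard_empty _⟩ ?_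
  rintro _ ⟨s, hs, rfl⟩
  rw [← hleaf]
  refine (hs.ncard_le_of_forall_exists_mem fun e => ?_).trans (hT.ncard_even_dist_le hc)
  induction e with
  | _ x y =>
    intro hxy
    have hd := hT.dist_eq_dist_add_one_of_adj c hxy
    by_cases hx : Even (T.dist c x)
    · exact ⟨x, hx, Sym2.mem_mk_left x y⟩
    · exact ⟨y, by grind, Sym2.mem_mk_right x y⟩
end
end
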